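/- arXiv:2206.15210 — 3 statements merged into one kernel-verified Lean document; each statement's English description precedes it below -/
import Mathlib

section
/- Suppose DK(A) = B and DK(A′) = B′, and let φ : A → A′ be a k-algebra isomorphism. Then: (i) φ restricts to an isomorphism from B onto B′ and from E onto E′; (ii) for each i with 1 ≤ i ≤ m there exist j with 1 ≤ j ≤ m and λ_j ∈ k* such that φ(x_i) = λ_j x_j′ and r_i = s_j; in particular, (r_1,…,r_m) equals (s_1,…,s_m) up to a permutation of {1,…,m}. -/
/-!
Common definitions: exponential maps, the Derksen and Makar-Limanov invariants,
𝔸ⁿ-fibrations, and the ring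
`A = k[X_1,…,X_m,Y,Z,T]/(X_1^{r_1}⋯X_m^{r_m}·Y − F(X_1,…,X_m,Z,T))`.
-/

noncomputable section
open MvPolynomial

/-- An exponential map on a `k`-algebra `D`: a `k`-algebra homomorphism `φ : D → D[U]`
such that evaluating `U` at `0` gives the identity of `D`, and such that
`φ_V ∘ φ_U = φ_{U+V}` in `D[U,V]` (where `φ_V : D[U] → D[U,V]` extends `φ` with
`φ_V(U) = U`).  Here `D[U,V]` is modelled as `Polynomial (Polynomial D)`, with inner
variable `U` and outer variable `V`. -/
structure ExpMap (k D : Type) [CommRing k] [CommRing D] [Algebra k D] where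
  toAlgHom : D →ₐ[k] Polynomial D
  eval_zero : ∀ d, Polynomial.eval 0 (toAlgHom d) = d
  comp_add : ∀ d,
    Polynomial.eval₂ ((Polynomial.mapRingHom (Polynomial.C (R := D))).comp toAlgHom.toRingHom)
      (Polynomial.C Polynomial.X) (toAlgHom d)
    = Polynomial.eval₂ ((Polynomial.C (R := Polynomial D)).comp (Polynomial.C (R := D)))
      (Polynomial.C Polynomial.X + Polynomial.X) (toAlgHom d)

namespace ExpMap
variable {k D : Type} [CommRing k] [CommRing D] [Algebra k D]

/-- The ring of invariants `D^φ = {d ∈ D | φ(d) = d}` of an exponential map. -/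
def invariants (φ : ExpMap k D) : Subalgebra k D where
  carrier := {d | φ.toAlgHom d = Polynomial.C d}
  mul_mem' := fun ha hb => by
    simp only [Set.mem_setOf_eq] at *
    rw [map_mul, ha, hb, ← map_mul]
  add_mem' := fun ha hb => by
    simp only [Set.mem_setOf_eq] at *
    rw [map_add, ha, hb, ← map_add]
  algebraMap_mem' := fun c => by
    simp only [Set.mem_setOf_eq, AlgHom.commutes, Polynomial.algebraMap_apply]

end ExpMap

/-- The Derksen invariant `DK(D)`: the `k`-subalgebra of `D` generated by the rings of
invariants of all non-trivial exponential maps on `D`. -/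
def Derksen (k D : Type) [CommRing k] [CommRing D] [Algebra k D] : Subalgebra k D :=
  Algebra.adjoin k (⋃ φ ∈ {ψ : ExpMap k D | ψ.invariants ≠ ⊤}, (φ.invariants : Set D))

/-- The Makar-Limanov invariant `ML(D)`: the intersection of the rings of invariants of
all exponential maps on `D`. -/
def MakarLimanov (k D : Type) [CommRing k] [CommRing D] [Algebra k D] : Subalgebra k D :=
  ⨅ φ : ExpMap k D, φ.invariants

/-- `D` is an `𝔸ⁿ`-fibration over `R`: a finitely generated flat `R`-algebra all of whose
fibres `D ⊗_R κ(p)` over primes `p` of `R` are polynomial rings `κ(p)^{[n]}`. -/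
def IsAnFibration (R D : Type) [CommRing R] [CommRing D] [Algebra R D] (n : ℕ) : Prop :=
  Algebra.FiniteType R D ∧ Module.Flat R D ∧
  ∀ p : PrimeSpectrum R,
    Nonempty ((TensorProduct R (IsLocalRing.ResidueField (Localization.AtPrime p.asIdeal)) D)
      ≃ₐ[IsLocalRing.ResidueField (Localization.AtPrime p.asIdeal)]
      MvPolynomial (Fin n) (IsLocalRing.ResidueField (Localization.AtPrime p.asIdeal)))

/-- The polynomial ring `k[X_1,…,X_m,Y,Z,T]`:
variables `Sum.inl i` are the `X i`; `Sum.inr 0 = Y`, `Sum.inr 1 = Z`, `Sum.inr 2 = T`. -/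
abbrev BigP (k : Type) [CommRing k] (m : ℕ) := MvPolynomial (Fin m ⊕ Fin 3) k

/-- The inclusion `k[X_1,…,X_m,Z,T] → k[X_1,…,X_m,Y,Z,T]` (in the source,
`Sum.inr 0 = Z` and `Sum.inr 1 = T`). -/
def incl (k : Type) [CommRing k] (m : ℕ) : MvPolynomial (Fin m ⊕ Fin 2) k →ₐ[k] BigP k m :=
  rename (Sum.map id Fin.succ)

/-- The polynomial `G = X_1^{r_1}⋯X_m^{r_m}·Y − F(X_1,…,X_m,Z,T)`. -/
def relG (k : Type) [CommRing k] (m : ℕ) (r : Fin m → ℕ) (F : MvPolynomial (Fin m ⊕ Fin 2) k) :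
    BigP k m :=
  (∏ i, X (Sum.inl i) ^ r i) * X (Sum.inr 0) - incl k m F

/-- The ring `A = k[X_1,…,X_m,Y,Z,T]/(X_1^{r_1}⋯X_m^{r_m}·Y − F(X_1,…,X_m,Z,T))`. -/
abbrev RingA (k : Type) [CommRing k] (m : ℕ) (r : Fin m → ℕ)
    (F : MvPolynomial (Fin m ⊕ Fin 2) k) :=
  BigP k m ⧸ Ideal.span {relG k m r F}

variable (k : Type) [CommRing k] (m : ℕ) (r : Fin m → ℕ) (F : MvPolynomial (Fin m ⊕ Fin 2) k)

/-- `x i`, the image of `X i` in `A`. -/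
def xA (i : Fin m) : RingA k m r F := Ideal.Quotient.mk _ (X (Sum.inl i))
/-- `y`, the image of `Y` in `A`. -/
def yA : RingA k m r F := Ideal.Quotient.mk _ (X (Sum.inr 0))
/-- `z`, the image of `Z` in `A`. -/
def zA : RingA k m r F := Ideal.Quotient.mk _ (X (Sum.inr 1))
/-- `t`, the image of `T` in `A`. -/
def tA : RingA k m r F := Ideal.Quotient.mk _ (X (Sum.inr 2))

/-- `f(Z,T) := F(0,…,0,Z,T) ∈ k[Z,T]`. -/
def fOf : MvPolynomial (Fin 2) k :=
  aeval (Sum.elim (fun _ => (0 : MvPolynomial (Fin 2) k)) X) F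

/-- The subalgebra `E = k[x_1,…,x_m]` of `A`. -/
def EA : Subalgebra k (RingA k m r F) := Algebra.adjoin k (Set.range (xA k m r F))

/-- The subalgebra `B = k[x_1,…,x_m,z,t]` of `A`. -/
def BA : Subalgebra k (RingA k m r F) :=
  Algebra.adjoin k (Set.range (xA k m r F) ∪ {zA k m r F, tA k m r F})

namespace ExpMap

/-- Transport of an exponential map along an isomorphism of algebras. -/
def transport {k D D' : Type} [CommRing k] [CommRing D] [Algebra k D] [CommRing D']
    [Algebra k D'] (φ : D ≃ₐ[k] D') (ψ : ExpMap k D) : ExpMap k D' where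
  toAlgHom := (Polynomial.mapAlgHom φ.toAlgHom).comp (ψ.toAlgHom.comp φ.symm.toAlgHom)
  eval_zero d := by
    have h := congrArg φ (ψ.eval_zero (φ.symm d))
    rw [AlgEquiv.apply_symm_apply] at h
    have h0 := Polynomial.eval_map_apply (f := (φ : D →+* D')) (p := ψ.toAlgHom (φ.symm d)) 0
    rw [map_zero] at h0
    exact h0.trans h
  comp_add d := by
    have h := congrArg (Polynomial.mapRingHom (Polynomial.mapRingHom (φ : D →+* D')))
      (ψ.comp_add (φ.symm d))
    rw [Polynomial.hom_eval₂, Polynomial.hom_eval₂] at h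
    change Polynomial.eval₂ _ _ (Polynomial.map (φ : D →+* D') (ψ.toAlgHom (φ.symm d))) =
      Polynomial.eval₂ _ _ (Polynomial.map (φ : D →+* D') (ψ.toAlgHom (φ.symm d)))
    rw [Polynomial.eval₂_map, Polynomial.eval₂_map]
    convert h using 2
    · ext a : 1
      change Polynomial.map _ (Polynomial.map (φ : D →+* D') (ψ.toAlgHom (φ.symm (φ a)))) =
        Polynomial.map _ (Polynomial.map _ (ψ.toAlgHom a))
      rw [AlgEquiv.symm_apply_apply, Polynomial.map_map, Polynomial.map_map]
      congr 1
      ext b : 1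
      simp
    · simp
    · ext a : 1
      simp
    · simp

theorem mem_invariants_transport {k D D' : Type} [CommRing k] [CommRing D] [Algebra k D]
    [CommRing D'] [Algebra k D'] (φ : D ≃ₐ[k] D') (ψ : ExpMap k D) (d : D) :
    φ d ∈ (ψ.transport φ).invariants ↔ d ∈ ψ.invariants := by
  change Polynomial.map (φ : D →+* D') (ψ.toAlgHom (φ.symm (φ d))) = Polynomial.C (φ d) ↔
    ψ.toAlgHom d = Polynomial.C d
  rw [AlgEquiv.symm_apply_apply]
  have : Polynomial.C (φ d) = Polynomial.map (φ : D →+* D') (Polynomial.C d) := by simp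
  rw [this]
  exact (Polynomial.map_injective _ φ.injective).eq_iff

/-- Units of a domain are invariant under every exponential map. -/
theorem mem_invariants_of_isUnit {k D : Type} [CommRing k] [CommRing D] [IsDomain D]
    [Algebra k D] (ψ : ExpMap k D) {d : D} (hd : IsUnit d) : d ∈ ψ.invariants := by
  change ψ.toAlgHom d = Polynomial.C d
  obtain ⟨c, -, hc⟩ := Polynomial.isUnit_iff.1 (hd.map ψ.toAlgHom)
  have h := ψ.eval_zero d
  rw [← hc, Polynomial.eval_C] at h
  rw [← hc, h]

end ExpMap

theorem map_derksen_le {k D D' : Type} [CommRing k] [CommRing D] [Algebra k D] [CommRing D']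
    [Algebra k D'] (φ : D ≃ₐ[k] D') :
    (Derksen k D).map φ.toAlgHom ≤ Derksen k D' := by
  rw [Derksen, AlgHom.map_adjoin, Algebra.adjoin_le_iff]
  rintro _ ⟨d, hd, rfl⟩
  simp only [Set.mem_iUnion] at hd
  obtain ⟨ψ, hψ, hd⟩ := hd
  apply Algebra.subset_adjoin
  simp only [Set.mem_iUnion]
  refine ⟨ψ.transport φ, fun h => hψ ?_, (ψ.mem_invariants_transport φ d).2 hd⟩
  rw [eq_top_iff]
  intro a _
  rw [← ψ.mem_invariants_transport φ, h]
  trivial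

theorem map_derksen {k D D' : Type} [CommRing k] [CommRing D] [Algebra k D] [CommRing D']
    [Algebra k D'] (φ : D ≃ₐ[k] D') :
    (Derksen k D).map φ.toAlgHom = Derksen k D' := by
  refine le_antisymm (map_derksen_le φ) fun d hd => ?_
  exact ⟨φ.symm d, map_derksen_le φ.symm ⟨d, hd, rfl⟩, φ.apply_symm_apply d⟩

namespace RingA

section CommRing

variable {k : Type} [CommRing k] {m : ℕ} (r : Fin m → ℕ) (F : MvPolynomial (Fin m ⊕ Fin 2) k)

/-- The canonical map `k[X_1,…,X_m,Z,T] → A`. -/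
def ofBase : MvPolynomial (Fin m ⊕ Fin 2) k →ₐ[k] RingA k m r F :=
  (Ideal.Quotient.mkₐ k _).comp (incl k m)

theorem ofBase_X_inl (i : Fin m) : ofBase r F (X (Sum.inl i)) = xA k m r F i := by
  simp [ofBase, incl, xA]

/-- The monomial `X_1^{r_1}⋯X_m^{r_m}`. -/
def monom (k : Type) [CommRing k] {m : ℕ} (r : Fin m → ℕ) : MvPolynomial (Fin m ⊕ Fin 2) k :=
  ∏ i, X (Sum.inl i) ^ r i

theorem ofBase_monom_mul_yA : ofBase r F (monom k r) * yA k m r F = ofBase r F F := by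
  have h : incl k m (monom k r) = ∏ i, X (Sum.inl i) ^ r i := by simp [incl, monom]
  change Ideal.Quotient.mk _ (incl k m (monom k r)) * Ideal.Quotient.mk _ (X (Sum.inr 0)) =
    Ideal.Quotient.mk _ (incl k m F)
  rw [h, ← map_mul, Ideal.Quotient.eq]
  exact Ideal.subset_span rfl

theorem range_ofBase : (ofBase r F).range = BA k m r F := by
  rw [← Algebra.map_top, ← MvPolynomial.adjoin_range_X, AlgHom.map_adjoin, BA]
  congr 1
  have h0 : ofBase r F (X (Sum.inr 0)) = zA k m r F := by simp [ofBase, incl, zA]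
  have h1 : ofBase r F (X (Sum.inr 1)) = tA k m r F := by simp [ofBase, incl, tA]
  ext a
  simp only [Set.mem_image, Set.mem_range, exists_exists_eq_and, Set.mem_union, Set.mem_insert_iff,
    Set.mem_singleton_iff, Sum.exists, ofBase_X_inl, Fin.exists_fin_two, h0, h1, or_and_right,
    exists_or, exists_eq_left', eq_comm (a := a)]

variable {r F} in
/-- The universal property of `A` over `k[X_1,…,X_m,Z,T]`. -/
theorem exists_lift {S : Type} [CommRing S] [Algebra k S]
    (f : MvPolynomial (Fin m ⊕ Fin 2) k →ₐ[k] S) (y : S) (h : f (monom k r) * y = f F) :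
    ∃ g : RingA k m r F →ₐ[k] S, (∀ b, g (ofBase r F b) = f b) ∧ g (yA k m r F) = y := by
  let g₀ : BigP k m →ₐ[k] S := aeval (Sum.elim (fun i => f (X (Sum.inl i)))
    (Fin.cons y fun j => f (X (Sum.inr j))))
  have hg : ∀ b, g₀ (incl k m b) = f b := by
    intro b
    have : g₀.comp (incl k m) = f := by
      apply MvPolynomial.algHom_ext
      rintro (i | j) <;> simp [g₀, incl]
    rw [← this, AlgHom.comp_apply]
  have hy : g₀ (X (Sum.inr 0)) = y := by simp [g₀]
  have hm : incl k m (monom k r) = ∏ i, X (Sum.inl i) ^ r i := by simp [incl, monom]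
  refine ⟨Ideal.Quotient.liftₐ _ g₀ fun a ha => ?_, hg, hy⟩
  have : Ideal.span {relG k m r F} ≤ RingHom.ker g₀ := by
    rw [Ideal.span_le, Set.singleton_subset_iff, SetLike.mem_coe, RingHom.mem_ker, relG, ← hm,
      map_sub, map_mul, hg, hg, hy, h, sub_self]
  exact this ha

/-- Every element of `A` becomes an element of the base after multiplication by a power
of `X_1^{r_1}⋯X_m^{r_m}`. -/
theorem exists_pow_mul_eq_ofBase (a : RingA k m r F) :
    ∃ n b, ofBase r F (monom k r) ^ n * a = ofBase r F b := by
  obtain ⟨p, rfl⟩ := Ideal.Quotient.mk_surjective a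
  induction p using MvPolynomial.induction_on with
  | C c =>
    refine ⟨0, C c, ?_⟩
    rw [pow_zero, one_mul]
    exact ((ofBase r F).commutes c).symm
  | add p q hp hq =>
    obtain ⟨n, b, hb⟩ := hp
    obtain ⟨n', b', hb'⟩ := hq
    refine ⟨n + n', monom k r ^ n' * b + monom k r ^ n * b', ?_⟩
    rw [map_add, map_add, map_mul, map_mul, ← hb, ← hb', map_pow, map_pow]
    ring
  | mul_X p j hp =>
    obtain ⟨n, b, hb⟩ := hp
    have base (v : Fin m ⊕ Fin 2) (hv : incl k m (X v) = X j) :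
        ∃ n b, ofBase r F (monom k r) ^ n * Ideal.Quotient.mk _ (p * X j) = ofBase r F b := by
      refine ⟨n, b * X v, ?_⟩
      rw [map_mul, map_mul, ← hb, ← hv, mul_assoc]
      rfl
    rcases j with i | j
    · exact base (Sum.inl i) (by simp [incl])
    · induction j using Fin.cases with
      | zero =>
        refine ⟨n + 1, b * F, ?_⟩
        rw [map_mul, map_mul, ← hb, ← ofBase_monom_mul_yA, yA]
        ring
      | succ l => exact base (Sum.inr l) (by simp [incl])

variable {r F}

theorem map_monom_eq_zero {S : Type} [CommRing S] [Algebra k S] {i : Fin m} {n : ℕ}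
    (hn : n ≤ r i) (f : MvPolynomial (Fin m ⊕ Fin 2) k →ₐ[k] S)
    (hX : f (X (Sum.inl i)) ^ n = 0) : f (monom k r) = 0 := by
  have : X (Sum.inl i) ^ n ∣ monom k r :=
    (pow_dvd_pow _ hn).trans (Finset.dvd_prod_of_mem _ (Finset.mem_univ i))
  obtain ⟨c, hc⟩ := this
  rw [hc, map_mul, map_pow, hX, zero_mul]

/-- For `n ≤ r_i`, the ring `A / x_i^n A` is a polynomial ring in `y` over
`k[X_1,…,X_m,Z,T] / (X_i^n, F)`; this is the consequence for elements of degree one in `y`. -/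
theorem mem_span_of_dvd {i : Fin m} {n : ℕ} (hn : n ≤ r i)
    {α β : MvPolynomial (Fin m ⊕ Fin 2) k}
    (h : xA k m r F i ^ n ∣ ofBase r F α * yA k m r F + ofBase r F β) :
    α ∈ Ideal.span {X (Sum.inl i) ^ n, F} ∧ β ∈ Ideal.span {X (Sum.inl i) ^ n, F} := by
  let I : Ideal (MvPolynomial (Fin m ⊕ Fin 2) k) := Ideal.span {X (Sum.inl i) ^ n, F}
  let f : MvPolynomial (Fin m ⊕ Fin 2) k →ₐ[k] Polynomial (MvPolynomial (Fin m ⊕ Fin 2) k ⧸ I) :=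
    Polynomial.CAlgHom.comp (Ideal.Quotient.mkₐ k I)
  have hf (b) : f b = Polynomial.C (Ideal.Quotient.mk I b) := rfl
  have hX : f (X (Sum.inl i)) ^ n = 0 := by
    rw [← map_pow, hf, Ideal.Quotient.eq_zero_iff_mem.2 (Ideal.subset_span (by simp)), map_zero]
  have hF : f F = 0 := by
    rw [hf, Ideal.Quotient.eq_zero_iff_mem.2 (Ideal.subset_span (by simp)), map_zero]
  have hm : f (monom k r) = 0 := map_monom_eq_zero
    (S := Polynomial (MvPolynomial (Fin m ⊕ Fin 2) k ⧸ I)) hn f hX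
  obtain ⟨g, hg, hy⟩ := exists_lift (r := r) (F := F)
    (S := Polynomial (MvPolynomial (Fin m ⊕ Fin 2) k ⧸ I)) f Polynomial.X
    (by rw [hm, hF, zero_mul])
  obtain ⟨c, hc⟩ := h
  have h := congrArg g hc
  rw [map_mul, map_pow, ← ofBase_X_inl, hg, hX, zero_mul, map_add, map_mul, hg, hg, hy, hf,
    hf] at h
  constructor
  · have := congrArg (Polynomial.coeff · 1) h
    simpa [Polynomial.coeff_C, Ideal.Quotient.eq_zero_iff_mem] using this
  · have := congrArg (Polynomial.coeff · 0) h
    simpa [Ideal.Quotient.eq_zero_iff_mem] using this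

end CommRing

section Field

variable {k : Type} [Field k] {m : ℕ} {r s : Fin m → ℕ} {F G : MvPolynomial (Fin m ⊕ Fin 2) k}

theorem monom_ne_zero : monom k r ≠ 0 :=
  Finset.prod_ne_zero_iff.2 fun _ _ => pow_ne_zero _ (X_ne_zero _)

theorem ofBase_injective (r : Fin m → ℕ) (F : MvPolynomial (Fin m ⊕ Fin 2) k) :
    Function.Injective (ofBase r F) := by
  let K := FractionRing (MvPolynomial (Fin m ⊕ Fin 2) k)
  let f : MvPolynomial (Fin m ⊕ Fin 2) k →ₐ[k] K := Algebra.algHom k _ K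
  have hf : Function.Injective f := IsFractionRing.injective (MvPolynomial (Fin m ⊕ Fin 2) k) K
  obtain ⟨g, hg, -⟩ := exists_lift (r := r) (F := F) f (f F / f (monom k r))
    (mul_div_cancel₀ _ ((map_ne_zero_iff f hf).2 monom_ne_zero))
  intro a b hab
  apply hf
  rw [← hg, ← hg, hab]

theorem fOf_eq_zero_of_mem {S : Set (Fin m)}
    (h : F ∈ Ideal.span ((fun i => X (Sum.inl i)) '' S)) : fOf k m F = 0 := by
  have : Ideal.span ((fun i => X (Sum.inl i)) '' S) ≤
      RingHom.ker (aeval (R := k) (Sum.elim (fun _ : Fin m => (0 : MvPolynomial (Fin 2) k)) X)) := by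
    rw [Ideal.span_le]
    rintro _ ⟨i, -, rfl⟩
    simp
  exact this h

theorem not_X_dvd (hF : fOf k m F ≠ 0) (i : Fin m) : ¬ X (Sum.inl i) ∣ F := fun h =>
  hF (fOf_eq_zero_of_mem (S := {i}) (by simpa [Ideal.mem_span_singleton] using h))

theorem isPrime_span_X_image {σ : Type*} (S : Set σ) :
    (Ideal.span (X '' S) : Ideal (MvPolynomial σ k)).IsPrime := by
  classical
  let θ : MvPolynomial σ k →ₐ[k] MvPolynomial σ k := aeval fun v => if v ∈ S then 0 else X v
  have h : Ideal.span (X '' S) = RingHom.ker θ := by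
    apply le_antisymm
    · rw [Ideal.span_le]
      rintro _ ⟨v, hv, rfl⟩
      simp [θ, hv]
    · intro p hp
      have hθ : (Ideal.Quotient.mkₐ k (Ideal.span (X '' S))).comp θ = Ideal.Quotient.mkₐ k _ := by
        apply MvPolynomial.algHom_ext
        intro v
        by_cases hv : v ∈ S
        · rw [AlgHom.comp_apply, aeval_X, if_pos hv, map_zero]
          exact (Ideal.Quotient.eq_zero_iff_mem.2
            (Ideal.subset_span (Set.mem_image_of_mem _ hv))).symm
        · rw [AlgHom.comp_apply, aeval_X, if_neg hv]
      have h := DFunLike.congr_fun hθ p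
      rw [AlgHom.comp_apply, (RingHom.mem_ker).1 hp, map_zero] at h
      exact Ideal.Quotient.eq_zero_iff_mem.1 h.symm
  rw [h]
  exact RingHom.ker_isPrime θ

theorem mem_span_of_X_mul_mem (hF : fOf k m F ≠ 0) {i j : Fin m} (hij : j ≠ i)
    {b : MvPolynomial (Fin m ⊕ Fin 2) k}
    (hb : X (Sum.inl j) * b ∈ Ideal.span {X (Sum.inl i), F}) :
    b ∈ Ideal.span {X (Sum.inl i), F} := by
  obtain ⟨c, d, h⟩ := Ideal.mem_span_pair.1 hb
  have hFd : F * d ∈ Ideal.span {X (Sum.inl i), X (Sum.inl j)} :=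
    Ideal.mem_span_pair.2 ⟨-c, b, by linear_combination -h⟩
  have hp := isPrime_span_X_image (k := k) {(Sum.inl i : Fin m ⊕ Fin 2), Sum.inl j}
  rw [Set.image_pair] at hp
  rcases hp.mem_or_mem hFd with hF' | hd
  · exact absurd (fOf_eq_zero_of_mem (S := {i, j}) (by rwa [Set.image_pair])) hF
  obtain ⟨d₁, d₂, rfl⟩ := Ideal.mem_span_pair.1 hd
  have hdvd : X (Sum.inl i) ∣ X (Sum.inl j) * (b - F * d₂) :=
    ⟨c + F * d₁, by linear_combination -h⟩
  rcases (X_prime (i := Sum.inl i)).dvd_or_dvd hdvd with hX | ⟨e, he⟩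
  · rw [X_dvd_X, Sum.inl.injEq] at hX
    exact absurd hX.symm hij
  · exact Ideal.mem_span_pair.2 ⟨e, d₂, by linear_combination -he⟩

theorem mem_span_of_prod_mul_mem (hF : fOf k m F ≠ 0) {i : Fin m} (S : Finset (Fin m))
    (hS : i ∉ S) {b : MvPolynomial (Fin m ⊕ Fin 2) k}
    (hb : b * ∏ j ∈ S, X (Sum.inl j) ^ r j ∈ Ideal.span {X (Sum.inl i), F}) :
    b ∈ Ideal.span {X (Sum.inl i), F} := by
  induction S using Finset.induction_on generalizing b with
  | empty => simpa using hb
  | insert j S hj ih =>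
    rw [Finset.prod_insert hj, ← mul_assoc] at hb
    have hb := ih (fun h => hS (Finset.mem_insert_of_mem h)) hb
    have hji : j ≠ i := fun h => hS (h ▸ Finset.mem_insert_self j S)
    clear ih
    generalize r j = n at hb
    induction n with
    | zero => simpa using hb
    | succ n ih =>
      exact ih (mem_span_of_X_mul_mem hF hji (by convert hb using 1; ring))

theorem not_isUnit_xA [IsDomain (RingA k m r F)]
    (hDK : Derksen k (RingA k m r F) = BA k m r F) (i : Fin m) : ¬ IsUnit (xA k m r F i) := by
  intro hu
  have hX : xA k m r F i ∈ BA k m r F := Algebra.subset_adjoin (Or.inl ⟨i, rfl⟩)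
  by_cases hψ : ∃ ψ : ExpMap k (RingA k m r F), ψ.invariants ≠ ⊤
  · obtain ⟨ψ, hψ⟩ := hψ
    obtain ⟨v, hv⟩ := hu.exists_right_inv
    have hvB : v ∈ BA k m r F := by
      rw [← hDK]
      apply Algebra.subset_adjoin
      simp only [Set.mem_iUnion]
      exact ⟨ψ, hψ, ψ.mem_invariants_of_isUnit (IsUnit.of_mul_eq_one_right _ hv)⟩
    rw [← range_ofBase] at hvB
    obtain ⟨w, hw⟩ := hvB
    change ofBase r F w = _ at hw
    rw [← hw, ← ofBase_X_inl, ← map_mul, ← map_one (ofBase r F)] at hv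
    exact (X_prime (R := k) (i := Sum.inl i)).not_isUnit
      (IsUnit.of_mul_eq_one _ (ofBase_injective r F hv))
  · push Not at hψ
    have : Derksen k (RingA k m r F) = ⊥ := by
      rw [eq_bot_iff, Derksen, Algebra.adjoin_le_iff]
      intro a ha
      simp only [Set.mem_iUnion] at ha
      obtain ⟨ψ, h, -⟩ := ha
      exact absurd (hψ ψ) h
    rw [← hDK, this] at hX
    obtain ⟨c, hc⟩ := Algebra.mem_bot.1 hX
    rw [← ofBase_X_inl, ← (ofBase r F).commutes] at hc
    have := congrArg totalDegree (ofBase_injective r F hc)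
    simp [algebraMap_eq] at this

/-- An isomorphism `A ≃ A'` mapping `B` onto `B'`, read on the polynomial rings. -/
theorem exists_equiv_base (φ : RingA k m r F ≃ₐ[k] RingA k m s G)
    (hB : (BA k m r F).map φ.toAlgHom = BA k m s G) :
    ∃ σ : MvPolynomial (Fin m ⊕ Fin 2) k ≃ₐ[k] MvPolynomial (Fin m ⊕ Fin 2) k,
      ∀ b, ofBase s G (σ b) = φ (ofBase r F b) := by
  rw [← range_ofBase, ← range_ofBase] at hB
  refine ⟨(AlgEquiv.ofInjective _ (ofBase_injective r F)).trans
    ((φ.subalgebraMap _).trans ((Subalgebra.equivOfEq _ _ hB).trans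
      (AlgEquiv.ofInjective _ (ofBase_injective s G)).symm)), fun b => ?_⟩
  have := AlgEquiv.ofInjective_apply (ofBase s G) (ofBase_injective s G)
  rw [← this]
  simp

theorem exists_map_xA_eq (hG : fOf k m G ≠ 0) (hs : ∀ i, s i ≠ 0)
    (φ : RingA k m r F ≃ₐ[k] RingA k m s G)
    (hB : (BA k m r F).map φ.toAlgHom = BA k m s G) (j : Fin m) :
    ∃ i : Fin m, ∃ c : k, c ≠ 0 ∧
      φ (xA k m r F i) = algebraMap k (RingA k m s G) c * xA k m s G j := by
  obtain ⟨σ, hσ⟩ := exists_equiv_base φ hB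
  obtain ⟨n, b, hb⟩ := exists_pow_mul_eq_ofBase r F (φ.symm (yA k m s G))
  have key : σ (monom k r) ^ n * G = monom k s * σ b := by
    apply ofBase_injective s G
    have h := congrArg φ hb
    rw [map_mul, map_pow, ← hσ, ← hσ, AlgEquiv.apply_symm_apply] at h
    rw [map_mul, map_mul, map_pow, ← h, ← ofBase_monom_mul_yA]
    ring
  have hX : X (Sum.inl j) ∣ monom k s :=
    (dvd_pow_self _ (hs j)).trans (Finset.dvd_prod_of_mem _ (Finset.mem_univ j))
  have hp : Prime (X (Sum.inl j) : MvPolynomial (Fin m ⊕ Fin 2) k) := X_prime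
  have h1 : X (Sum.inl j) ∣ σ (monom k r) :=
    hp.dvd_of_dvd_pow ((hp.dvd_or_dvd (key ▸ hX.mul_right _)).resolve_right (not_X_dvd hG j))
  rw [monom, map_prod, hp.dvd_finsetProd_iff] at h1
  obtain ⟨i, -, hi⟩ := h1
  rw [map_pow] at hi
  have hσi : Prime (σ (X (Sum.inl i))) :=
    (MulEquiv.prime_iff σ.toMulEquiv).2 (X_prime (i := Sum.inl i))
  obtain ⟨u, hu⟩ := hp.associated_of_dvd hσi (hp.dvd_of_dvd_pow hi)
  obtain ⟨c, hc, hcu⟩ := MvPolynomial.isUnit_iff_eq_C_of_isReduced.1 u.isUnit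
  refine ⟨i, c, hc.ne_zero, ?_⟩
  rw [← ofBase_X_inl, ← hσ, ← hu, hcu, ← ofBase_X_inl, ← (ofBase s G).commutes, ← map_mul,
    algebraMap_eq, mul_comm]

theorem le_of_map_xA_eq [IsDomain (RingA k m r F)] (hF : fOf k m F ≠ 0) (hr : ∀ i, r i ≠ 0)
    (hDK : Derksen k (RingA k m r F) = BA k m r F)
    (φ : RingA k m r F ≃ₐ[k] RingA k m s G)
    (hB : (BA k m r F).map φ.toAlgHom = BA k m s G) {i j : Fin m} {c : k} (hc : c ≠ 0)
    (h : φ (xA k m r F i) = algebraMap k (RingA k m s G) c * xA k m s G j) :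
    s j ≤ r i := by
  by_contra! hlt
  obtain ⟨σ, hσ⟩ := exists_equiv_base φ hB
  have hdvd {q : MvPolynomial (Fin m ⊕ Fin 2) k} {u : Fin m → ℕ} (l : Fin m) :
      xA k m u q l ^ u l ∣ ofBase u q q := by
    rw [← ofBase_monom_mul_yA, ← ofBase_X_inl, ← map_pow]
    exact (map_dvd _ (Finset.dvd_prod_of_mem _ (Finset.mem_univ l))).mul_right _
  have hcu : IsUnit (algebraMap k (RingA k m s G) c) := hc.isUnit.map _
  have hσX : σ (X (Sum.inl i)) = C c * X (Sum.inl j) := by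
    apply ofBase_injective s G
    rw [hσ, ofBase_X_inl, h, map_mul, ofBase_X_inl, ← algebraMap_eq, AlgHom.commutes]
  obtain ⟨g, rfl⟩ := σ.surjective G
  have hg : xA k m r F i ^ s j ∣ ofBase r F g := by
    rw [← map_dvd_iff φ, ← hσ, map_pow, h, mul_pow, (hcu.pow _).mul_left_dvd]
    exact hdvd j
  have hFg : F ∈ Ideal.span {X (Sum.inl i), g} := by
    have h1 : xA k m s (σ g) j ^ 1 ∣
        ofBase s (σ g) 0 * yA k m s (σ g) + ofBase s (σ g) (σ F) := by
      rw [map_zero, zero_mul, zero_add, hσ, pow_one]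
      have := map_dvd φ ((dvd_pow_self _ (hr i)).trans (hdvd (q := F) (u := r) i))
      rw [h, hcu.mul_left_dvd] at this
      exact this
    obtain ⟨a, b, hab⟩ := Ideal.mem_span_pair.1 (mem_span_of_dvd (by omega) h1).2
    rw [pow_one] at hab
    obtain ⟨a, rfl⟩ := σ.surjective a
    obtain ⟨b, rfl⟩ := σ.surjective b
    refine Ideal.mem_span_pair.2 ⟨a * C c⁻¹, b, σ.injective ?_⟩
    have hcc : (C c⁻¹ * C c : MvPolynomial (Fin m ⊕ Fin 2) k) = 1 := by
      rw [← C_mul, inv_mul_cancel₀ hc, C_1]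
    rw [map_add, map_mul, map_mul, map_mul, hσX, ← algebraMap_eq, AlgEquiv.commutes, algebraMap_eq]
    linear_combination hab + σ a * X (Sum.inl j) * hcc
  have hgr : g ∈ Ideal.span {X (Sum.inl i) ^ r i, F} := by
    refine (mem_span_of_dvd (r := r) (i := i) (α := 0) le_rfl ?_).2
    rw [map_zero, zero_mul, zero_add]
    exact (pow_dvd_pow _ hlt.le).trans hg
  obtain ⟨β, α, hβα⟩ := Ideal.mem_span_pair.1 hgr
  let Q : MvPolynomial (Fin m ⊕ Fin 2) k := ∏ l ∈ Finset.univ.erase i, X (Sum.inl l) ^ r l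
  have hQ : monom k r = X (Sum.inl i) ^ r i * Q :=
    (Finset.mul_prod_erase _ _ (Finset.mem_univ i)).symm
  have hx : xA k m r F i ≠ 0 := by
    rw [← ofBase_X_inl, map_ne_zero_iff _ (ofBase_injective r F)]
    exact X_ne_zero _
  have hα : xA k m r F i ^ 1 ∣ ofBase r F (α * Q) * yA k m r F + ofBase r F β := by
    obtain ⟨w, hw⟩ := hg
    refine (pow_dvd_pow _ (show 1 ≤ s j - r i by omega)).trans ⟨w, ?_⟩
    apply mul_left_cancel₀ (pow_ne_zero (r i) hx)
    rw [← mul_assoc, ← pow_add, Nat.add_sub_cancel' hlt.le, ← hw, ← hβα, map_add, map_mul _ α F,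
      ← ofBase_monom_mul_yA, hQ, ← ofBase_X_inl]
    simp only [map_mul, map_pow]
    ring
  have hα' := (mem_span_of_dvd (Nat.one_le_iff_ne_zero.2 (hr i)) hα).1
  rw [pow_one] at hα'
  obtain ⟨a, b, rfl⟩ := Ideal.mem_span_pair.1
    (mem_span_of_prod_mul_mem hF _ (Finset.notMem_erase i _) hα')
  obtain ⟨e, d, hed⟩ := Ideal.mem_span_pair.1 hFg
  obtain ⟨n, hn⟩ := Nat.exists_eq_succ_of_ne_zero (hr i)
  have h1 : X (Sum.inl i) ∣ F * (1 - F * b * d) := by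
    refine ⟨e + β * X (Sum.inl i) ^ n * d + a * F * d, ?_⟩
    rw [hn, pow_succ] at hβα
    linear_combination -hed - d * hβα
  obtain ⟨v, hv⟩ := ((X_prime).dvd_or_dvd h1).resolve_left (not_X_dvd hF i)
  apply not_isUnit_xA hDK i
  rw [isUnit_iff_dvd_one]
  have h2 := congrArg (ofBase r F) (sub_eq_iff_eq_add.1 hv)
  rw [map_one, map_add, map_mul, ofBase_X_inl, mul_assoc, map_mul] at h2
  rw [h2]
  exact (dvd_mul_right _ _).add
    (((dvd_pow_self _ (hr i)).trans (hdvd i)).mul_right _)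

end Field

end RingA

/-!
STATEMENT 14 (Theorem `isocl` (i),(ii)).  Suppose `DK(A) = B`, `DK(A′) = B′` and
`φ : A → A′` is a `k`-algebra isomorphism, where
`A = k[X_1,…,X_m,Y,Z,T]/(X_1^{r_1}⋯X_m^{r_m}Y − F)` and
`A′ = k[X_1,…,X_m,Y,Z,T]/(X_1^{s_1}⋯X_m^{s_m}Y − G)`.  Then
(i) `φ` restricts to isomorphisms `B → B′` and `E → E′`;
(ii) for each `i` there are `j` and `λ_j ∈ k*` with `φ(x_i) = λ_j x_j′` and `r_i = s_j`;
in particular `(r_1,…,r_m) = (s_1,…,s_m)` up to a permutation of `{1,…,m}`.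
-/

theorem statement14 (k : Type) [Field k] (m : ℕ) (hm : 1 ≤ m)
    (r s : Fin m → ℕ) (hr : ∀ i, 1 < r i) (hs : ∀ i, 1 < s i)
    (F G : MvPolynomial (Fin m ⊕ Fin 2) k)
    (hfF : fOf k m F ≠ 0) (hfG : fOf k m G ≠ 0)
    [IsDomain (RingA k m r F)] [IsDomain (RingA k m s G)]
    (hDK : Derksen k (RingA k m r F) = BA k m r F)
    (hDK' : Derksen k (RingA k m s G) = BA k m s G)
    (φ : RingA k m r F ≃ₐ[k] RingA k m s G) :
    Subalgebra.map φ.toAlgHom (BA k m r F) = BA k m s G ∧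
    Subalgebra.map φ.toAlgHom (EA k m r F) = EA k m s G ∧
    (∀ i : Fin m, ∃ j : Fin m, ∃ lam : k, lam ≠ 0 ∧
      φ (xA k m r F i) = algebraMap k (RingA k m s G) lam * xA k m s G j ∧ r i = s j) ∧
    (∃ σ : Equiv.Perm (Fin m), ∀ i, r i = s (σ i)) := by
  have hB : (BA k m r F).map φ.toAlgHom = BA k m s G := by
    rw [← hDK, ← hDK', map_derksen]
  have hB' : (BA k m s G).map φ.symm.toAlgHom = BA k m r F := by
    rw [← hDK, ← hDK', map_derksen]
  have hr' (i) : r i ≠ 0 := by have := hr i; omega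
  have hs' (i) : s i ≠ 0 := by have := hs i; omega
  have swap {i j : Fin m} {c : k} (hc : c ≠ 0)
      (h : φ.symm (xA k m s G j) = algebraMap k _ c * xA k m r F i) :
      φ (xA k m r F i) = algebraMap k _ c⁻¹ * xA k m s G j := by
    have h := congrArg φ h
    rw [AlgEquiv.apply_symm_apply, map_mul, AlgEquiv.commutes] at h
    rw [h, ← mul_assoc, ← map_mul, inv_mul_cancel₀ hc, map_one, one_mul]
  have main (i : Fin m) : ∃ j : Fin m, ∃ lam : k, lam ≠ 0 ∧
      φ (xA k m r F i) = algebraMap k (RingA k m s G) lam * xA k m s G j ∧ r i = s j := by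
    obtain ⟨j, c, hc, h⟩ := RingA.exists_map_xA_eq hfF hr' φ.symm hB' i
    exact ⟨j, c⁻¹, inv_ne_zero hc, swap hc h, le_antisymm
      (RingA.le_of_map_xA_eq hfG hs' hDK' φ.symm hB' hc h)
      (RingA.le_of_map_xA_eq hfF hr' hDK φ hB (inv_ne_zero hc) (swap hc h))⟩
  refine ⟨hB, ?_, main, ?_⟩
  · rw [EA, EA, AlgHom.map_adjoin]
    apply le_antisymm
    · rw [Algebra.adjoin_le_iff]
      rintro _ ⟨_, ⟨i, rfl⟩, rfl⟩
      obtain ⟨j, c, -, h, -⟩ := main i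
      change φ (xA k m r F i) ∈ _
      rw [h]
      exact mul_mem (algebraMap_mem _ c) (Algebra.subset_adjoin ⟨j, rfl⟩)
    · rw [Algebra.adjoin_le_iff]
      rintro _ ⟨j, rfl⟩
      obtain ⟨i, c, hc, h⟩ := RingA.exists_map_xA_eq hfG hs' φ hB j
      have h' : xA k m s G j = algebraMap k _ c⁻¹ * φ (xA k m r F i) := by
        rw [h, ← mul_assoc, ← map_mul, inv_mul_cancel₀ hc, map_one, one_mul]
      rw [h']
      exact mul_mem (algebraMap_mem _ _) (Algebra.subset_adjoin ⟨_, ⟨i, rfl⟩, rfl⟩)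
  · choose σ c hc h hrs using main
    have hσ : Function.Injective σ := by
      intro i i' hii
      have h1 : φ (RingA.ofBase r F (C (c i') * X (Sum.inl i))) =
          φ (RingA.ofBase r F (C (c i) * X (Sum.inl i'))) := by
        simp only [map_mul, RingA.ofBase_X_inl, h, hii, ← algebraMap_eq, AlgHom.commutes,
          AlgEquiv.commutes]
        ring
      have h2 := RingA.ofBase_injective r F (φ.injective h1)
      have h3 : (X (Sum.inl i) : MvPolynomial (Fin m ⊕ Fin 2) k) ∣ C (c i) * X (Sum.inl i') :=
        h2 ▸ dvd_mul_left _ _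
      rw [(((hc i).isUnit).map C).dvd_mul_left, X_dvd_X] at h3
      simpa using h3
    exact ⟨Equiv.ofBijective σ (Finite.injective_iff_bijective.1 hσ), hrs⟩
end
end

section
/- Suppose DK(A) = B and DK(A′) = B′, and let φ : A → A′ be a k-algebra isomorphism. Then: (iii) φ maps the ideal (x_1^{r_1}⋯x_m^{r_m}, F(x_1,…,x_m,z,t))B of B onto the ideal ((x_1′)^{s_1}⋯(x_m′)^{s_m}, G(x_1′,…,x_m′,z′,t′))B′ of B′; and (iv) there exist a k-algebra automorphism α of k[Z,T] and λ ∈ k* such that α(g) = λ·f. -/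
/-!
Common definitions: exponential maps, the Derksen and Makar-Limanov invariants,
𝔸ⁿ-fibrations, and the ring
`A = k[X_1,…,X_m,Y,Z,T]/(X_1^{r_1}⋯X_m^{r_m}·Y − F(X_1,…,X_m,Z,T))`.
-/

noncomputable section
open MvPolynomial

variable (k : Type) [CommRing k] (m : ℕ) (r : Fin m → ℕ) (F : MvPolynomial (Fin m ⊕ Fin 2) k)

/-!
STATEMENT 15 (Theorem `isocl` (iii),(iv)).  Suppose `DK(A) = B`, `DK(A′) = B′` and
`φ : A → A′` is a `k`-algebra isomorphism.  Then
(iii) `φ` maps the ideal `(x_1^{r_1}⋯x_m^{r_m}, F(x_1,…,x_m,z,t))B` of `B` onto the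
ideal `((x_1′)^{s_1}⋯(x_m′)^{s_m}, G(x_1′,…,x_m′,z′,t′))B′` of `B′`;
(iv) there are a `k`-algebra automorphism `α` of `k[Z,T]` and `λ ∈ k*` with
`α(g) = λ·f`.

The ideal `(u, v)B`, viewed as a subset of `A`, is `{u·b + v·c : b, c ∈ B}`.
-/

/-- The subset of `A` given by the ideal `(x_1^{r_1}⋯x_m^{r_m}, F(x_1,…,x_m,z,t))B`
of `B = k[x_1,…,x_m,z,t]`. -/
def idealUF (k : Type) [CommRing k] (m : ℕ) (r : Fin m → ℕ)
    (F : MvPolynomial (Fin m ⊕ Fin 2) k) : Set (RingA k m r F) :=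
  {a | ∃ b ∈ BA k m r F, ∃ c ∈ BA k m r F,
    a = (∏ i, xA k m r F i ^ r i) * b + Ideal.Quotient.mk _ (incl k m F) * c}

/-! ### Affine modifications -/

/-- `A` is generated by `y` over the image of `ι : R → A`, and every relation satisfied by `y`
is a multiple of `P * y = F`; that is, `A = R[Y] / (P * Y - F)`. -/
structure IsAffineModification {R A : Type} [CommRing R] [CommRing A] (ι : R →+* A) (y : A)
    (P F : R) : Prop where
  surj : ∀ a, ∃ p : Polynomial R, p.eval₂ ι y = a
  dvd : ∀ p : Polynomial R, p.eval₂ ι y = 0 →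
    Polynomial.C P * Polynomial.X - Polynomial.C F ∣ p
  rel : ι P * y = ι F

namespace IsAffineModification

variable {R A : Type} [CommRing R] [CommRing A] {ι : R →+* A} {y y' : A} {P F Q G : R}

theorem injective [IsDomain R] (h : IsAffineModification ι y P F) (hP : P ≠ 0) :
    Function.Injective ι := by
  rw [injective_iff_map_eq_zero]
  intro a ha
  obtain ⟨q, hq⟩ := h.dvd (Polynomial.C a) (by simpa using ha)
  by_contra ha0
  have hdeg : (Polynomial.C P * Polynomial.X - Polynomial.C F).natDegree = 1 := by
    rw [sub_eq_add_neg, ← Polynomial.C_neg]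
    exact Polynomial.natDegree_linear hP
  have hne : Polynomial.C a ≠ 0 := by simpa using ha0
  have h1 := Polynomial.natDegree_le_of_dvd ⟨q, hq⟩ hne
  rw [hdeg, Polynomial.natDegree_C] at h1
  omega

/-- The contraction of `d A` to `R` is contained in `(d, F)` whenever `d` divides `P`. -/
theorem contraction (h : IsAffineModification ι y P F) {d b : R} (hd : d ∣ P) {w : A}
    (hb : ι b = ι d * w) : ∃ u v, b = d * u + F * v := by
  obtain ⟨p, rfl⟩ := h.surj w
  obtain ⟨e, rfl⟩ := hd
  obtain ⟨q, hq⟩ := h.dvd (Polynomial.C b - Polynomial.C d * p) (by simp [hb])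
  have h0 := congrArg (fun p => Polynomial.coeff p 0) hq
  simp only [sub_mul, Polynomial.coeff_sub, mul_assoc, Polynomial.coeff_C_mul,
    Polynomial.coeff_C_zero, Polynomial.coeff_X_mul_zero] at h0
  exact ⟨p.coeff 0, -q.coeff 0, by linear_combination h0⟩

theorem exists_pow_mul_mem_range (h : IsAffineModification ι y P F) (a : A) :
    ∃ (N : ℕ) (c : R), ι P ^ N * a = ι c := by
  obtain ⟨p, rfl⟩ := h.surj a
  induction p using Polynomial.induction_on' with
  | add p q hp hq =>
    obtain ⟨N, c, hc⟩ := hp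
    obtain ⟨M, d, hd⟩ := hq
    refine ⟨N + M, P ^ M * c + P ^ N * d, ?_⟩
    simp only [Polynomial.eval₂_add, map_add, map_mul, map_pow, ← hc, ← hd]
    ring
  | monomial n a =>
    refine ⟨n, a * F ^ n, ?_⟩
    simp only [Polynomial.eval₂_monomial, map_mul, map_pow, ← h.rel]
    ring

/-- A prime which is a denominator of some element of `A` divides `P`. -/
theorem prime_dvd (h : IsAffineModification ι y P F) (hι : Function.Injective ι)
    {p : R} (hp : Prime p) (hrel : ι Q * y' = ι G) (hpQ : p ∣ Q) (hpG : ¬ p ∣ G) : p ∣ P := by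
  obtain ⟨N, c, hc⟩ := h.exists_pow_mul_mem_range y'
  have h1 : P ^ N * G = Q * c := hι (by
    simp only [map_mul, map_pow, ← hrel, ← hc]; ring)
  have h2 : p ∣ P ^ N * G := h1 ▸ hpQ.mul_right c
  exact hp.dvd_of_dvd_pow ((hp.dvd_or_dvd h2).resolve_right hpG)

/-- Comparison of two presentations of the same ring whose denominators have different orders
at `p`. -/
theorem cofactor_mem [IsDomain A] (h : IsAffineModification ι y P F)
    (h' : IsAffineModification ι y' Q G) {p P' : R} (hp : ι p ≠ 0) {n : ℕ} (hn : n ≠ 0)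
    (hP : P = p ^ n * P') (hQ : p ^ (n + 1) ∣ Q) : ∃ u v, P' = p * u + F * v := by
  obtain ⟨b, c, hF⟩ := h'.contraction (d := p ^ n) (b := F) (w := ι P' * y)
    ((pow_dvd_pow p n.le_succ).trans hQ) (by rw [← h.rel, hP, map_mul]; ring)
  obtain ⟨Q', rfl⟩ := hQ
  have h1 : ι P' * y = ι b + ι p * (ι Q' * y' * ι c) := by
    apply mul_left_cancel₀ (pow_ne_zero n hp)
    have e1 := h.rel
    have e2 := h'.rel
    rw [hF, hP] at e1
    simp only [map_mul, map_pow, map_add] at e1 e2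
    linear_combination e1 - ι c * e2
  obtain ⟨w, hw⟩ := h.surj (ι Q' * y' * ι c)
  obtain ⟨q, hq⟩ := h.dvd
    (Polynomial.C P' * Polynomial.X - Polynomial.C b - Polynomial.C p * w) (by
      simp [h1, hw])
  have h0 := congrArg (fun p => Polynomial.coeff p 1) hq
  simp only [sub_mul, Polynomial.coeff_sub, mul_assoc, Polynomial.coeff_C_mul,
    Polynomial.coeff_X_one, Polynomial.coeff_X_mul, Polynomial.coeff_C_succ] at h0
  obtain ⟨n, rfl⟩ := Nat.exists_eq_succ_of_ne_zero hn
  refine ⟨w.coeff 1 + p ^ n * P' * q.coeff 0, -q.coeff 1, ?_⟩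
  rw [hP, pow_succ] at h0
  linear_combination h0

end IsAffineModification

/-! ### The Derksen invariant -/

section Derksen

variable {k D D' : Type} [CommRing k] [CommRing D] [Algebra k D] [CommRing D'] [Algebra k D']

/-- Transport of an exponential map along an isomorphism. -/
def ExpMap.transport_s15 (ψ : ExpMap k D) (e : D ≃ₐ[k] D') : ExpMap k D' where
  toAlgHom := (Polynomial.mapAlgHom (e : D →ₐ[k] D')).comp (ψ.toAlgHom.comp e.symm)
  eval_zero d := by
    have h := congrArg e (ψ.eval_zero (e.symm d))
    simp only [AlgEquiv.apply_symm_apply] at h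
    conv_rhs => rw [← h]
    have := Polynomial.eval_map_apply (f := (e : D →+* D')) (p := ψ.toAlgHom (e.symm d)) 0
    simp at this ⊢
  comp_add d := by
    have h := congrArg (Polynomial.mapRingHom (Polynomial.mapRingHom (e : D →+* D')))
      (ψ.comp_add (e.symm d))
    rw [Polynomial.hom_eval₂, Polynomial.hom_eval₂] at h
    have hd : ((Polynomial.mapAlgHom (e : D →ₐ[k] D')).comp (ψ.toAlgHom.comp e.symm)) d =
        (ψ.toAlgHom (e.symm d)).map (e : D →+* D') := rfl
    rw [hd, Polynomial.eval₂_map, Polynomial.eval₂_map]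
    convert h using 2
    · refine RingHom.ext fun a => ?_
      change ((ψ.toAlgHom (e.symm (e a))).map (e : D →+* D')).map Polynomial.C =
        ((ψ.toAlgHom a).map Polynomial.C).map (Polynomial.mapRingHom (e : D →+* D'))
      rw [AlgEquiv.symm_apply_apply, Polynomial.map_map, Polynomial.map_map]
      congr 1
      ext
      simp
    · simp
    · ext; simp
    · simp

theorem ExpMap.mem_invariants_transport_s15 (ψ : ExpMap k D) (e : D ≃ₐ[k] D') {d : D} :
    e d ∈ (ψ.transport_s15 e).invariants ↔ d ∈ ψ.invariants := by
  change (ψ.toAlgHom (e.symm (e d))).map (e : D →+* D') = Polynomial.C (e d) ↔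
    ψ.toAlgHom d = Polynomial.C d
  rw [AlgEquiv.symm_apply_apply]
  constructor
  · intro h
    apply Polynomial.map_injective (e : D →+* D') e.injective
    simpa using h
  · intro h
    simp [h]

theorem Derksen.map_le (e : D ≃ₐ[k] D') :
    (Derksen k D).map (e : D →ₐ[k] D') ≤ Derksen k D' := by
  rw [Derksen, AlgHom.map_adjoin]
  apply Algebra.adjoin_mono
  rintro _ ⟨d, hd, rfl⟩
  simp only [Set.mem_iUnion, Set.mem_ofPred_eq] at hd ⊢
  obtain ⟨ψ, hψ, hd⟩ := hd
  refine ⟨ψ.transport_s15 e, fun h => hψ ?_, (ψ.mem_invariants_transport_s15 e).2 hd⟩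
  rw [eq_top_iff]
  intro a _
  rw [← ψ.mem_invariants_transport_s15 e, h]
  trivial

/-- If a domain has a non-trivial exponential map, its Derksen invariant contains all units. -/
theorem Derksen.isUnit_mem [IsDomain D] (h : Derksen k D ≠ ⊥) {u : D} (hu : IsUnit u) :
    u ∈ Derksen k D := by
  obtain ⟨ψ, hψ⟩ : ∃ ψ : ExpMap k D, ψ.invariants ≠ ⊤ := by
    by_contra! hc
    apply h
    simp [Derksen, hc]
  apply Algebra.subset_adjoin
  simp only [Set.mem_iUnion, Set.mem_ofPred_eq]
  refine ⟨ψ, hψ, ?_⟩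
  obtain ⟨a, -, ha⟩ := Polynomial.isUnit_iff.1 (hu.map ψ.toAlgHom)
  have h0 := ψ.eval_zero u
  rw [← ha, Polynomial.eval_C] at h0
  subst h0
  exact ha.symm

end Derksen

/-! ### Monomials in polynomial rings -/

section Monomials

variable {k : Type} [Field k] {m : ℕ}

/-- The map `k[X_1,…,X_m,Z,T] → k[Z,T]` sending each `X_i` to `0`. -/
def evalZero (k : Type) [Field k] (m : ℕ) :
    MvPolynomial (Fin m ⊕ Fin 2) k →ₐ[k] MvPolynomial (Fin 2) k :=
  aeval (Sum.elim (fun _ => 0) X)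

theorem not_X_dvd_of_evalZero_ne_zero {F : MvPolynomial (Fin m ⊕ Fin 2) k}
    (hF : evalZero k m F ≠ 0) (i : Fin m) : ¬ X (Sum.inl i) ∣ F := by
  rintro ⟨c, rfl⟩
  simp [evalZero] at hF

theorem not_associated_X {i j : Fin m} (h : i ≠ j) :
    ¬ Associated (X (Sum.inl i) : MvPolynomial (Fin m ⊕ Fin 2) k) (X (Sum.inl j)) := by
  intro h1
  have := h1.dvd
  rw [X_dvd_X] at this
  simp_all

theorem isRelPrime_of_prime {R : Type} [CommRing R] [IsDomain R] {p q : R} (hp : Prime p)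
    (h : ¬ p ∣ q) : IsRelPrime p q :=
  (hp.irreducible.isRelPrime_iff_not_dvd).2 h

/-- If a monomial in the `X_j`, `j ≠ i`, lies in `(X_i, F)`, then `X_i` divides `F - c` for a
nonzero constant `c`. -/
theorem exists_eq_C_add_of_prod_mem {F : MvPolynomial (Fin m ⊕ Fin 2) k}
    (hF : evalZero k m F ≠ 0) (r : Fin m → ℕ) (i : Fin m)
    (h : ∃ u v, ∏ j ∈ Finset.univ.erase i, X (Sum.inl j) ^ r j = X (Sum.inl i) * u + F * v) :
    ∃ c : k, c ≠ 0 ∧ ∃ w, F = C c + X (Sum.inl i) * w := by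
  obtain ⟨u, v, h⟩ := h
  let e : MvPolynomial (Fin m ⊕ Fin 2) k →ₐ[k] MvPolynomial (Fin m ⊕ Fin 2) k :=
    aeval (Function.update X (Sum.inl i) 0)
  have hei : e (X (Sum.inl i)) = 0 := by simp [e]
  have hej : ∀ j, j ≠ i → e (X (Sum.inl j)) = X (Sum.inl j) := fun j hj => by
    simp [e, Function.update_of_ne (show (Sum.inl j : Fin m ⊕ Fin 2) ≠ Sum.inl i by simpa using hj)]
  have he0 : (evalZero k m).comp e = evalZero k m := by
    ext x : 1
    by_cases hx : x = Sum.inl i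
    · subst hx; simp [hei, evalZero]
    · simp [e, Function.update_of_ne hx]
  have hed : ∀ b, X (Sum.inl i) ∣ b - e b := by
    intro b
    rw [← Ideal.mem_span_singleton, ← Ideal.Quotient.eq]
    have : (Ideal.Quotient.mkₐ k (Ideal.span {X (Sum.inl i)})) =
        (Ideal.Quotient.mkₐ k (Ideal.span {X (Sum.inl i)})).comp e := by
      ext x : 1
      by_cases hx : x = Sum.inl i
      · subst hx
        simp [hei]
      · simp [e, Function.update_of_ne hx]
    exact DFunLike.congr_fun this b
  have h1 := congrArg e h
  rw [map_add, map_mul, map_mul, hei, zero_mul, zero_add, map_prod] at h1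
  have heF : evalZero k m (e F) ≠ 0 := by
    rw [← AlgHom.comp_apply, he0]; exact hF
  have h2 : IsRelPrime (e F) (∏ j ∈ Finset.univ.erase i, e (X (Sum.inl j) ^ r j)) := by
    apply IsRelPrime.prod_right
    intro j hj
    rw [map_pow, hej j (Finset.ne_of_mem_erase hj)]
    exact (isRelPrime_of_prime X_prime (not_X_dvd_of_evalZero_ne_zero heF j)).symm.pow_right
  have h3 : IsUnit (e F) := h2 dvd_rfl ⟨_, h1⟩
  obtain ⟨c, hc, hce⟩ := MvPolynomial.isUnit_iff_eq_C_of_isReduced.1 h3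
  obtain ⟨w, hw⟩ := hed F
  exact ⟨c, hc.ne_zero, w, by rw [← hce, ← hw]; ring⟩

end Monomials

/-! ### Comparing two presentations of the same ring -/

section Comparison

variable {k : Type} [Field k] {m : ℕ} {A : Type} [CommRing A] [IsDomain A] [Algebra k A]
  {ι : MvPolynomial (Fin m ⊕ Fin 2) k →ₐ[k] A} {y y' : A}
  {F G : MvPolynomial (Fin m ⊕ Fin 2) k} {r s : Fin m → ℕ}

theorem prod_X_pow_ne_zero (r : Fin m → ℕ) :
    (∏ i, X (Sum.inl i) ^ r i : MvPolynomial (Fin m ⊕ Fin 2) k) ≠ 0 :=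
  Finset.prod_ne_zero_iff.2 fun _ _ => pow_ne_zero _ (X_ne_zero _)

/-- If the Derksen invariant is the coefficient ring, no `X_i` becomes invertible. -/
theorem not_isUnit_map_X (hι : Function.Injective ι) (hDK : Derksen k A = ι.range) (i : Fin m) :
    ¬ IsUnit (ι (X (Sum.inl i))) := by
  intro hu
  obtain ⟨u, hu⟩ := hu
  have hbot : Derksen k A ≠ ⊥ := by
    intro h
    have h1 : ι (X (Sum.inl i)) ∈ (⊥ : Subalgebra k A) := by
      rw [← h, hDK]; exact ⟨_, rfl⟩
    obtain ⟨c, hc⟩ := Algebra.mem_bot.1 h1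
    rw [← ι.commutes c] at hc
    have h2 := congrArg (eval (fun _ => c + 1)) (hι hc)
    simp [algebraMap_eq] at h2
  have hmem := Derksen.isUnit_mem hbot u⁻¹.isUnit
  rw [hDK] at hmem
  obtain ⟨b, hb⟩ := hmem
  have h1 : X (Sum.inl i) * b = 1 := hι (by
    rw [map_mul, map_one, ← hu]
    exact (congrArg _ hb).trans u.mul_inv)
  exact (X_prime (R := k) (i := (Sum.inl i : Fin m ⊕ Fin 2))).not_isUnit (IsUnit.of_mul_eq_one _ h1)

variable (hr : ∀ i, 1 < r i) (hF : evalZero k m F ≠ 0)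
  (h : IsAffineModification (ι : MvPolynomial (Fin m ⊕ Fin 2) k →+* A) y
    (∏ i, X (Sum.inl i) ^ r i) F)
  {θ : MvPolynomial (Fin m ⊕ Fin 2) k ≃ₐ[k] MvPolynomial (Fin m ⊕ Fin 2) k}
  (hs : ∀ i, 1 < s i) (hG : evalZero k m G ≠ 0)
  (h' : IsAffineModification (ι : MvPolynomial (Fin m ⊕ Fin 2) k →+* A) y'
    (θ (∏ i, X (Sum.inl i) ^ s i)) (θ G))
include h h' hG hs

omit [IsDomain A] in
theorem exists_associated_X (j : Fin m) :
    ∃ i, Associated (θ (X (Sum.inl j))) (X (Sum.inl i)) := by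
  have hι := h.injective (prod_X_pow_ne_zero r)
  have hp : Prime (θ (X (Sum.inl j))) := (MulEquiv.prime_iff θ).2 X_prime
  have h1 : θ (X (Sum.inl j)) ∣ ∏ i, X (Sum.inl i) ^ r i := by
    refine h.prime_dvd hι hp h'.rel (map_dvd θ ?_) ?_
    · exact (dvd_pow_self _ (by have := hs j; omega)).trans
        (Finset.dvd_prod_of_mem _ (Finset.mem_univ j))
    · rw [map_dvd_iff]
      exact not_X_dvd_of_evalZero_ne_zero hG j
  obtain ⟨i, -, hi⟩ := hp.exists_mem_finset_dvd h1
  exact ⟨i, hp.associated_of_dvd X_prime (hp.dvd_of_dvd_pow hi)⟩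

include hr hF in
theorem map_prod_dvd (hDK : Derksen k A = ι.range) :
    θ (∏ i, X (Sum.inl i) ^ s i) ∣ ∏ i, X (Sum.inl i) ^ r i := by
  have hι : Function.Injective ι := h.injective (prod_X_pow_ne_zero r)
  rw [map_prod]
  apply Finset.prod_dvd_of_isRelPrime
  · intro i _ j _ hij
    have h1 : IsRelPrime (θ (X (Sum.inl i))) (θ (X (Sum.inl j))) := by
      apply isRelPrime_of_prime ((MulEquiv.prime_iff θ).2 X_prime)
      rw [map_dvd_iff]
      intro hd
      exact not_associated_X hij (X_prime.associated_of_dvd X_prime hd)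
    simpa only [Function.onFun, map_pow] using h1.pow
  · intro j _
    obtain ⟨i, hi⟩ := exists_associated_X h hs hG h' j
    rw [map_pow, (hi.pow_pow).dvd_iff_dvd_left]
    refine (pow_dvd_pow _ ?_).trans (Finset.dvd_prod_of_mem _ (Finset.mem_univ i))
    by_contra! hlt
    have hQ : X (Sum.inl i) ^ (r i + 1) ∣ θ (∏ i, X (Sum.inl i) ^ s i) := by
      refine (pow_dvd_pow _ hlt).trans (hi.symm.pow_pow.dvd.trans ?_)
      rw [← map_pow]
      exact map_dvd θ (Finset.dvd_prod_of_mem _ (Finset.mem_univ j))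
    have h2 := h.cofactor_mem h' (p := X (Sum.inl i)) (n := r i)
      (P' := ∏ j ∈ Finset.univ.erase i, X (Sum.inl j) ^ r j)
      ((map_ne_zero_iff _ hι).2 (X_ne_zero _)) (by have := hr i; omega)
      (Finset.mul_prod_erase _ _ (Finset.mem_univ i)).symm hQ
    obtain ⟨c, hc, w, hw⟩ := exists_eq_C_add_of_prod_mem hF r i h2
    apply not_isUnit_map_X hι hDK i
    have hXP : X (Sum.inl i) ∣ ∏ i, (X (Sum.inl i) : MvPolynomial (Fin m ⊕ Fin 2) k) ^ r i :=
      (dvd_pow_self _ (by have := hr i; omega)).trans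
        (Finset.dvd_prod_of_mem _ (Finset.mem_univ i))
    obtain ⟨P', hP'⟩ := hXP
    have h3 := h.rel
    rw [hP', hw] at h3
    simp only [RingHom.coe_coe, map_mul, map_add] at h3
    have h4 : IsUnit (ι (C c)) := ((isUnit_iff_ne_zero.2 hc).map C).map ι
    refine isUnit_of_dvd_unit ⟨ι P' * y - ι w, ?_⟩ h4
    linear_combination -h3

end Comparison

/-! ### The ring `A` as an affine modification -/

section RingA

variable (k : Type) [Field k] (m : ℕ) (r : Fin m → ℕ) (F : MvPolynomial (Fin m ⊕ Fin 2) k)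

/-- The structure map `k[X_1,…,X_m,Z,T] → A`. -/
def RingA.base : MvPolynomial (Fin m ⊕ Fin 2) k →ₐ[k] RingA k m r F :=
  (Ideal.Quotient.mkₐ k _).comp (incl k m)

/-- The map `k[X_1,…,X_m,Y,Z,T] → k[X_1,…,X_m,Z,T][Y]`. -/
def toPolynomial : BigP k m →ₐ[k] Polynomial (MvPolynomial (Fin m ⊕ Fin 2) k) :=
  aeval (Sum.elim (fun i => Polynomial.C (X (Sum.inl i)))
    ![Polynomial.X, Polynomial.C (X (Sum.inr 0)), Polynomial.C (X (Sum.inr 1))])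

theorem toPolynomial_incl (a : MvPolynomial (Fin m ⊕ Fin 2) k) :
    toPolynomial k m (incl k m a) = Polynomial.C a := by
  have : (toPolynomial k m).comp (incl k m) =
      Polynomial.CAlgHom (R := k) (A := MvPolynomial (Fin m ⊕ Fin 2) k) := by
    ext x : 1
    rcases x with i | j
    · simp [toPolynomial, incl]
    · fin_cases j <;> simp [toPolynomial, incl]
  exact DFunLike.congr_fun this a

theorem eval₂_toPolynomial (a : BigP k m) :
    (toPolynomial k m a).eval₂ (incl k m : _ →+* BigP k m) (X (Sum.inr 0)) = a := by
  induction a using MvPolynomial.induction_on with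
  | C c =>
    rw [← algebraMap_eq, AlgHom.commutes]
    simp
  | add p q hp hq => rw [map_add, Polynomial.eval₂_add, hp, hq]
  | mul_X p n hp =>
    rw [map_mul, Polynomial.eval₂_mul, hp]
    congr 1
    rcases n with i | j
    · simp [toPolynomial, incl]
    · fin_cases j <;> simp [toPolynomial, incl]

theorem toPolynomial_eval₂ (p : Polynomial (MvPolynomial (Fin m ⊕ Fin 2) k)) :
    toPolynomial k m (p.eval₂ (incl k m : _ →+* BigP k m) (X (Sum.inr 0))) = p := by
  induction p using Polynomial.induction_on' with
  | add p q hp hq => rw [Polynomial.eval₂_add, map_add, hp, hq]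
  | monomial n a =>
    rw [Polynomial.eval₂_monomial, map_mul, map_pow, RingHom.coe_coe, toPolynomial_incl,
      ← Polynomial.C_mul_X_pow_eq_monomial]
    simp [toPolynomial]

theorem incl_prod : incl k m (∏ i, X (Sum.inl i) ^ r i) = ∏ i, X (Sum.inl i) ^ r i := by
  simp [incl]

theorem RingA.base_prod :
    RingA.base k m r F (∏ i, X (Sum.inl i) ^ r i) = ∏ i, xA k m r F i ^ r i := by
  simp [RingA.base, incl, xA]

theorem RingA.isAffineModification :
    IsAffineModification (RingA.base k m r F : _ →+* RingA k m r F) (yA k m r F)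
      (∏ i, X (Sum.inl i) ^ r i) F := by
  have key : ∀ p : Polynomial (MvPolynomial (Fin m ⊕ Fin 2) k),
      p.eval₂ (RingA.base k m r F : _ →+* RingA k m r F) (yA k m r F) =
      Ideal.Quotient.mk _ (p.eval₂ (incl k m : _ →+* BigP k m) (X (Sum.inr 0))) := by
    intro p
    rw [Polynomial.hom_eval₂]
    rfl
  refine ⟨fun a => ?_, fun p hp => ?_, ?_⟩
  · obtain ⟨b, rfl⟩ := Ideal.Quotient.mk_surjective a
    exact ⟨toPolynomial k m b, by rw [key, eval₂_toPolynomial]⟩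
  · rw [key, Ideal.Quotient.eq_zero_iff_mem, Ideal.mem_span_singleton] at hp
    have h := map_dvd (toPolynomial k m) hp
    rw [toPolynomial_eval₂] at h
    convert h using 1
    rw [relG, map_sub, map_mul, toPolynomial_incl, ← incl_prod, toPolynomial_incl]
    simp [toPolynomial]
  · have h : Ideal.Quotient.mk (Ideal.span {relG k m r F}) (relG k m r F) = 0 :=
      Ideal.Quotient.eq_zero_iff_mem.2 (Ideal.mem_span_singleton_self _)
    have h1 : relG k m r F = incl k m (∏ i, X (Sum.inl i) ^ r i) * X (Sum.inr 0) - incl k m F := by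
      rw [relG, incl_prod]
    conv at h => enter [1, 2]; rw [h1]
    rw [map_sub, map_mul, sub_eq_zero] at h
    exact h

theorem RingA.range_base : (RingA.base k m r F).range = BA k m r F := by
  rw [← Algebra.map_top, ← adjoin_range_X, AlgHom.map_adjoin, BA, ← Set.range_comp]
  have hl : ∀ i, RingA.base k m r F (X (Sum.inl i)) = xA k m r F i := fun i => by
    simp [RingA.base, incl, xA]
  have hz : RingA.base k m r F (X (Sum.inr 0)) = zA k m r F := by
    simp [RingA.base, incl, zA]
  have ht : RingA.base k m r F (X (Sum.inr 1)) = tA k m r F := by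
    simp [RingA.base, incl, tA]
  congr 1
  ext a
  simp [Fin.exists_fin_two, hl, hz, ht, eq_comm (b := a)]
  tauto

variable {k m r F}

theorem mem_idealUF {a : RingA k m r F} : a ∈ idealUF k m r F ↔
    ∃ b c, a = RingA.base k m r F ((∏ i, X (Sum.inl i) ^ r i) * b + F * c) := by
  simp only [idealUF, ← RingA.range_base, ← RingA.base_prod, map_add, map_mul]
  constructor
  · rintro ⟨_, ⟨b, rfl⟩, _, ⟨c, rfl⟩, rfl⟩
    exact ⟨b, c, rfl⟩
  · rintro ⟨b, c, rfl⟩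
    exact ⟨_, ⟨b, rfl⟩, _, ⟨c, rfl⟩, rfl⟩

theorem RingA.base_injective : Function.Injective (RingA.base k m r F) :=
  (RingA.isAffineModification k m r F).injective (prod_X_pow_ne_zero r)

variable {s : Fin m → ℕ} {G : MvPolynomial (Fin m ⊕ Fin 2) k}

theorem exists_base_lift (hDK : Derksen k (RingA k m r F) = BA k m r F)
    (hDK' : Derksen k (RingA k m s G) = BA k m s G) (φ : RingA k m r F ≃ₐ[k] RingA k m s G) :
    ∃ θ : MvPolynomial (Fin m ⊕ Fin 2) k →ₐ[k] MvPolynomial (Fin m ⊕ Fin 2) k,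
      ∀ b, RingA.base k m s G (θ b) = φ (RingA.base k m r F b) := by
  have hmem : ∀ b, φ (RingA.base k m r F b) ∈ (RingA.base k m s G).range := by
    intro b
    rw [RingA.range_base, ← hDK']
    apply Derksen.map_le φ
    refine ⟨_, ?_, rfl⟩
    rw [hDK, ← RingA.range_base]
    exact ⟨b, rfl⟩
  let e := AlgEquiv.ofInjective (RingA.base k m s G) RingA.base_injective
  refine ⟨(e.symm : _ →ₐ[k] _).comp
    (((φ : RingA k m r F →ₐ[k] RingA k m s G).comp (RingA.base k m r F)).codRestrict _ hmem), fun b => ?_⟩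
  exact congrArg Subtype.val (e.apply_symm_apply ⟨_, hmem b⟩)

/-- An isomorphism restricts to the coefficient rings. -/
theorem exists_base_equiv (hDK : Derksen k (RingA k m r F) = BA k m r F)
    (hDK' : Derksen k (RingA k m s G) = BA k m s G) (φ : RingA k m r F ≃ₐ[k] RingA k m s G) :
    ∃ θ : MvPolynomial (Fin m ⊕ Fin 2) k ≃ₐ[k] MvPolynomial (Fin m ⊕ Fin 2) k,
      ∀ b, RingA.base k m s G (θ b) = φ (RingA.base k m r F b) := by
  obtain ⟨θ, hθ⟩ := exists_base_lift hDK hDK' φ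
  obtain ⟨η, hη⟩ := exists_base_lift hDK' hDK φ.symm
  refine ⟨AlgEquiv.ofAlgHom θ η ?_ ?_, hθ⟩
  · refine AlgHom.ext fun b => RingA.base_injective (r := s) (F := G) ?_
    simp [hθ, hη]
  · refine AlgHom.ext fun b => RingA.base_injective (r := r) (F := F) ?_
    simp [hθ, hη]

/-- Transport of the presentation of `A` to `A'`. -/
theorem isAffineModification_transport {φ : RingA k m r F ≃ₐ[k] RingA k m s G}
    {θ : MvPolynomial (Fin m ⊕ Fin 2) k ≃ₐ[k] MvPolynomial (Fin m ⊕ Fin 2) k}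
    (hθ : ∀ b, RingA.base k m s G (θ b) = φ (RingA.base k m r F b)) :
    IsAffineModification (RingA.base k m s G : _ →+* RingA k m s G) (φ (yA k m r F))
      (θ (∏ i, X (Sum.inl i) ^ r i)) (θ F) := by
  have h := RingA.isAffineModification k m r F
  have key : ∀ p : Polynomial (MvPolynomial (Fin m ⊕ Fin 2) k),
      (p.map (θ : _ →+* MvPolynomial (Fin m ⊕ Fin 2) k)).eval₂
        (RingA.base k m s G : _ →+* RingA k m s G) (φ (yA k m r F)) =
      φ (p.eval₂ (RingA.base k m r F : _ →+* RingA k m r F) (yA k m r F)) := by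
    intro p
    have := Polynomial.hom_eval₂ p (RingA.base k m r F : _ →+* RingA k m r F)
      (φ : RingA k m r F →+* RingA k m s G) (yA k m r F)
    rw [Polynomial.eval₂_map]
    refine Eq.trans ?_ this.symm
    congr 1
    exact RingHom.ext hθ
  refine ⟨fun a => ?_, fun p hp => ?_, ?_⟩
  · obtain ⟨p, hp⟩ := h.surj (φ.symm a)
    exact ⟨_, by rw [key, hp, AlgEquiv.apply_symm_apply]⟩
  · have hp' : p = (p.map (θ.symm : _ →+* MvPolynomial (Fin m ⊕ Fin 2) k)).map
        (θ : _ →+* MvPolynomial (Fin m ⊕ Fin 2) k) := by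
      ext n : 1
      rw [Polynomial.coeff_map, Polynomial.coeff_map]
      exact (θ.apply_symm_apply _).symm
    rw [hp', key, EmbeddingLike.map_eq_zero_iff] at hp
    rw [hp']
    have h1 := map_dvd (Polynomial.mapRingHom (θ : _ →+* MvPolynomial (Fin m ⊕ Fin 2) k))
      (h.dvd _ hp)
    rwa [map_sub, map_mul, Polynomial.coe_mapRingHom, Polynomial.map_C, Polynomial.map_X,
      Polynomial.map_C] at h1
  · change RingA.base k m s G (θ _) * φ _ = RingA.base k m s G (θ F)
    rw [hθ, hθ, ← map_mul]
    exact congrArg φ h.rel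

/-- The endomorphism of `k[Z,T]` induced by an automorphism of `k[X_1,…,X_m,Z,T]`. -/
def descend (θ : MvPolynomial (Fin m ⊕ Fin 2) k ≃ₐ[k] MvPolynomial (Fin m ⊕ Fin 2) k) :
    MvPolynomial (Fin 2) k →ₐ[k] MvPolynomial (Fin 2) k :=
  (evalZero k m).comp ((θ : MvPolynomial (Fin m ⊕ Fin 2) k →ₐ[k] MvPolynomial (Fin m ⊕ Fin 2) k).comp
    (rename Sum.inr))

theorem descend_evalZero
    {θ : MvPolynomial (Fin m ⊕ Fin 2) k ≃ₐ[k] MvPolynomial (Fin m ⊕ Fin 2) k}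
    (h : ∀ j, ∃ i, Associated (θ (X (Sum.inl j))) (X (Sum.inl i)))
    (b : MvPolynomial (Fin m ⊕ Fin 2) k) :
    descend θ (evalZero k m b) = evalZero k m (θ b) := by
  have : (descend θ).comp (evalZero k m) =
      (evalZero k m).comp (θ : _ →ₐ[k] MvPolynomial (Fin m ⊕ Fin 2) k) := by
    ext x : 1
    rcases x with j | j
    · obtain ⟨i, hi⟩ := h j
      obtain ⟨c, hc⟩ := hi.symm.dvd
      simp [evalZero, hc]
    · simp [descend, evalZero]
  exact DFunLike.congr_fun this b

theorem descend_descend_symm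
    {θ : MvPolynomial (Fin m ⊕ Fin 2) k ≃ₐ[k] MvPolynomial (Fin m ⊕ Fin 2) k}
    (h : ∀ j, ∃ i, Associated (θ (X (Sum.inl j))) (X (Sum.inl i))) :
    (descend θ).comp (descend θ.symm) = AlgHom.id k _ := by
  ext x : 1
  rw [AlgHom.comp_apply]
  change descend θ (evalZero k m (θ.symm (rename Sum.inr (X x)))) = X x
  rw [descend_evalZero h]
  simp [evalZero]

section Isomorphism

variable (hr : ∀ i, 1 < r i) (hs : ∀ i, 1 < s i)
  (hF : evalZero k m F ≠ 0) (hG : evalZero k m G ≠ 0)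
  (hDK : Derksen k (RingA k m r F) = BA k m r F)
  {φ : RingA k m r F ≃ₐ[k] RingA k m s G}
  {θ : MvPolynomial (Fin m ⊕ Fin 2) k ≃ₐ[k] MvPolynomial (Fin m ⊕ Fin 2) k}
  (hθ : ∀ b, RingA.base k m s G (θ b) = φ (RingA.base k m r F b))

include hθ in
theorem base_symm (b : MvPolynomial (Fin m ⊕ Fin 2) k) :
    RingA.base k m r F (θ.symm b) = φ.symm (RingA.base k m s G b) := by
  rw [AlgEquiv.eq_symm_apply, ← hθ, AlgEquiv.apply_symm_apply]

variable [IsDomain (RingA k m r F)]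
include hr hs hF hG hDK hθ

theorem dvd_map_prod :
    ∏ i, X (Sum.inl i) ^ s i ∣ θ (∏ i, X (Sum.inl i) ^ r i) := by
  have h := map_prod_dvd hr hF (RingA.isAffineModification k m r F) hs hG
    (isAffineModification_transport (φ := φ.symm) (θ := θ.symm) (base_symm hθ))
    (hDK.trans (RingA.range_base k m r F).symm)
  simpa only [AlgEquiv.apply_symm_apply] using map_dvd θ h

/-- The restriction of an isomorphism maps `F` into the ideal `(X^s, G)`. -/
theorem exists_map_eq : ∃ u v, θ F = (∏ i, X (Sum.inl i) ^ s i) * u + G * v := by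
  obtain ⟨c, hc⟩ := dvd_map_prod hr hs hF hG hDK hθ
  have h := (isAffineModification_transport hθ).rel
  rw [hc, map_mul, mul_assoc] at h
  exact (RingA.isAffineModification k m s G).contraction dvd_rfl h.symm

theorem image_idealUF_subset : φ '' idealUF k m r F ⊆ idealUF k m s G := by
  rintro _ ⟨a, ha, rfl⟩
  obtain ⟨b, c, rfl⟩ := mem_idealUF.1 ha
  obtain ⟨w, hw⟩ := dvd_map_prod hr hs hF hG hDK hθ
  obtain ⟨u, v, huv⟩ := exists_map_eq hr hs hF hG hDK hθ
  refine mem_idealUF.2 ⟨w * θ b + u * θ c, v * θ c, ?_⟩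
  rw [← hθ, map_add, map_mul, map_mul, hw, huv]
  congr 1
  ring

theorem evalZero_dvd_evalZero_map (hm : 1 ≤ m) : evalZero k m G ∣ evalZero k m (θ F) := by
  obtain ⟨u, v, huv⟩ := exists_map_eq hr hs hF hG hDK hθ
  have h0 : evalZero k m (∏ i, X (Sum.inl i) ^ s i) = 0 := by
    rw [map_prod]
    refine Finset.prod_eq_zero (Finset.mem_univ ⟨0, hm⟩) ?_
    have := hs ⟨0, hm⟩
    simp [evalZero, show s ⟨0, hm⟩ ≠ 0 by omega]
  exact ⟨evalZero k m v, by rw [huv, map_add, map_mul, h0, zero_mul, zero_add, map_mul]⟩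

end Isomorphism

end RingA

theorem statement15 (k : Type) [Field k] (m : ℕ) (hm : 1 ≤ m)
    (r s : Fin m → ℕ) (hr : ∀ i, 1 < r i) (hs : ∀ i, 1 < s i)
    (F G : MvPolynomial (Fin m ⊕ Fin 2) k)
    (hfF : fOf k m F ≠ 0) (hfG : fOf k m G ≠ 0)
    [IsDomain (RingA k m r F)] [IsDomain (RingA k m s G)]
    (hDK : Derksen k (RingA k m r F) = BA k m r F)
    (hDK' : Derksen k (RingA k m s G) = BA k m s G)
    (φ : RingA k m r F ≃ₐ[k] RingA k m s G) :
    (⇑φ '' idealUF k m r F = idealUF k m s G) ∧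
    (∃ α : MvPolynomial (Fin 2) k ≃ₐ[k] MvPolynomial (Fin 2) k, ∃ lam : k, lam ≠ 0 ∧
      α (fOf k m G) = C lam * fOf k m F) := by
  obtain ⟨θ, hθ⟩ := exists_base_equiv hDK hDK' φ
  have hθ' := base_symm hθ
  have h1 := exists_associated_X (RingA.isAffineModification k m s G) hr hfF
    (isAffineModification_transport hθ)
  have h2 := exists_associated_X (RingA.isAffineModification k m r F) hs hfG
    (isAffineModification_transport (θ := θ.symm) hθ')
  refine ⟨(image_idealUF_subset hr hs hfF hfG hDK hθ).antisymm fun a ha => ?_, ?_⟩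
  · exact ⟨φ.symm a, image_idealUF_subset hs hr hfG hfF hDK' hθ' ⟨a, ha, rfl⟩,
      φ.apply_symm_apply a⟩
  · let α : MvPolynomial (Fin 2) k ≃ₐ[k] MvPolynomial (Fin 2) k :=
      AlgEquiv.ofAlgHom (descend θ.symm) (descend θ)
        (descend_descend_symm (θ := θ.symm) h2) (descend_descend_symm h1)
    have hα : ∀ b, α (evalZero k m b) = evalZero k m (θ.symm b) := descend_evalZero h2
    have d1 : fOf k m F ∣ α (fOf k m G) :=
      (evalZero_dvd_evalZero_map hs hr hfG hfF hDK' hθ' hm).trans (hα G).symm.dvd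
    have d2 : α (fOf k m G) ∣ fOf k m F := by
      have h := map_dvd α (evalZero_dvd_evalZero_map hr hs hfF hfG hDK hθ hm)
      rwa [hα (θ F), AlgEquiv.symm_apply_apply] at h
    obtain ⟨u, hu⟩ := associated_of_dvd_dvd d2 d1
    obtain ⟨c, hc, hcu⟩ := MvPolynomial.isUnit_iff_eq_C_of_isReduced.1 u⁻¹.isUnit
    refine ⟨α, c, hc.ne_zero, ?_⟩
    rw [← hcu, ← hu, mul_comm, mul_assoc, u.mul_inv, mul_one]
end
end

section
/- Suppose F(X_1,…,X_m,Z,T) = f(Z,T) + h(X_1,…,X_m,Z,T) with h ∈ (X_1,…,X_m)k[X_1,…,X_m,Z,T], and suppose DK(A) = B. Let I = (x_1^{r_1}⋯x_m^{r_m}, F(x_1,…,x_m,z,t))B. If φ is a k-algebra automorphism of A, then: (a) φ restricts to an automorphism of E and of B; (b) for each i with 1 ≤ i ≤ m there exist j with 1 ≤ j ≤ m and λ_j ∈ k* such that φ(x_i) = λ_j x_j and r_i = r_j; (c) φ(I) = I. Conversely, if a k-algebra endomorphism φ of A satisfies (a) and (c), then φ satisfies (b) and φ is an automorphism of A. -/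
/-!
Common definitions: exponential maps, the Derksen and Makar-Limanov invariants,
𝔸ⁿ-fibrations, and the ring
`A = k[X_1,…,X_m,Y,Z,T]/(X_1^{r_1}⋯X_m^{r_m}·Y − F(X_1,…,X_m,Z,T))`.
-/

noncomputable section
open MvPolynomial

variable (k : Type) [CommRing k] (m : ℕ) (r : Fin m → ℕ) (F : MvPolynomial (Fin m ⊕ Fin 2) k)

section Polynomial

variable {K : Type} [Field K] {n : ℕ} {s : Fin n → ℕ} {G : MvPolynomial (Fin n ⊕ Fin 2) K}

/-- The monomial `X_1^{r_1}⋯X_m^{r_m}` in `k[X_1,…,X_m,Z,T]`. -/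
def monomialX (K : Type) [CommRing K] {n : ℕ} (s : Fin n → ℕ) :
    MvPolynomial (Fin n ⊕ Fin 2) K :=
  ∏ i, X (Sum.inl i) ^ s i

theorem X_pow_dvd_monomialX (i : Fin n) :
    (X (Sum.inl i) ^ s i : MvPolynomial (Fin n ⊕ Fin 2) K) ∣ monomialX K s :=
  Finset.dvd_prod_of_mem (fun i => (X (Sum.inl i) ^ s i : MvPolynomial (Fin n ⊕ Fin 2) K))
    (Finset.mem_univ i)

theorem X_dvd_monomialX {i : Fin n} (hi : s i ≠ 0) :
    (X (Sum.inl i) : MvPolynomial (Fin n ⊕ Fin 2) K) ∣ monomialX K s :=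
  (dvd_pow_self _ hi).trans (X_pow_dvd_monomialX i)

theorem monomialX_eq_X_pow_mul (i : Fin n) :
    monomialX K s = X (Sum.inl i) ^ s i * ∏ l ∈ Finset.univ.erase i, X (Sum.inl l) ^ s l :=
  (Finset.mul_prod_erase _ _ (Finset.mem_univ i)).symm

theorem monomialX_ne_zero : monomialX K s ≠ 0 :=
  Finset.prod_ne_zero_iff.2 fun _ _ => pow_ne_zero _ (X_ne_zero _)

theorem not_X_dvd_of_fOf_ne_zero (hf : fOf K n G ≠ 0) (i : Fin n) : ¬ X (Sum.inl i) ∣ G := by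
  rintro ⟨c, rfl⟩
  exact hf (by simp [fOf])

theorem isRelPrime_X_of_fOf_ne_zero (hf : fOf K n G ≠ 0) (i : Fin n) :
    IsRelPrime G (X (Sum.inl i)) :=
  ((X_prime.irreducible.isRelPrime_iff_not_dvd).2 (not_X_dvd_of_fOf_ne_zero hf i)).symm

theorem isRelPrime_monomialX_of_fOf_ne_zero (hf : fOf K n G ≠ 0) :
    IsRelPrime G (monomialX K s) :=
  IsRelPrime.prod_right fun i _ => (isRelPrime_X_of_fOf_ne_zero hf i).pow_right

/-- If a monomial in the `X_l`, `l ≠ i`, lies in the ideal `(X_i, F)`, then `F` is congruent to a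
nonzero constant modulo `X_i`. -/
theorem exists_eq_C_add_X_mul (hf : fOf K n G ≠ 0) {i : Fin n}
    {a b : MvPolynomial (Fin n ⊕ Fin 2) K}
    (h : ∏ l ∈ Finset.univ.erase i, X (Sum.inl l) ^ s l = X (Sum.inl i) * a + G * b) :
    ∃ c : K, c ≠ 0 ∧ ∃ g, G = C c + X (Sum.inl i) * g := by
  let S : MvPolynomial (Fin n ⊕ Fin 2) K →ₐ[K] MvPolynomial (Fin n ⊕ Fin 2) K :=
    aeval fun v => if v = Sum.inl i then 0 else X v
  have hSi : S (X (Sum.inl i)) = 0 := by simp [S]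
  have hfS : fOf K n (S G) = fOf K n G := by
    have : (aeval (Sum.elim (fun _ => (0 : MvPolynomial (Fin 2) K)) X)).comp S =
        aeval (Sum.elim (fun _ : Fin n => (0 : MvPolynomial (Fin 2) K)) X) := by
      ext v : 1
      simp only [S, AlgHom.comp_apply, aeval_X]
      split_ifs with hv <;> simp [hv]
    exact DFunLike.congr_fun this G
  have hw : S (∏ l ∈ Finset.univ.erase i, X (Sum.inl l) ^ s l) =
      ∏ l ∈ Finset.univ.erase i, X (Sum.inl l) ^ s l := by
    rw [map_prod]
    refine Finset.prod_congr rfl fun l hl => ?_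
    simp [S, Finset.ne_of_mem_erase hl]
  have hdvd : S G ∣ ∏ l ∈ Finset.univ.erase i, X (Sum.inl l) ^ s l := by
    rw [← hw, h, map_add, map_mul, map_mul, hSi, zero_mul, zero_add]
    exact dvd_mul_right _ _
  have hrel : IsRelPrime (S G) (∏ l ∈ Finset.univ.erase i, X (Sum.inl l) ^ s l) :=
    IsRelPrime.prod_right fun l _ => (isRelPrime_X_of_fOf_ne_zero (hfS ▸ hf) l).pow_right
  obtain ⟨c, hc, hcS⟩ := MvPolynomial.isUnit_iff_eq_C_of_isReduced.1 (hrel.isUnit_of_dvd hdvd)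
  refine ⟨c, hc.ne_zero, ?_⟩
  have hker : ∀ p, X (Sum.inl i) ∣ p - S p := by
    intro p
    induction p using MvPolynomial.induction_on with
    | C a => simp [S]
    | add p q hp hq => simpa [add_sub_add_comm] using dvd_add hp hq
    | mul_X p v hp =>
      by_cases hv : v = Sum.inl i
      · simp [hv, hSi]
      · have : S (X v) = X v := by simp [S, hv]
        rw [map_mul, this, ← sub_mul]
        exact hp.mul_right _
  obtain ⟨g, hg⟩ := hker G
  exact ⟨g, by rw [← hcS, ← hg]; ring⟩

end Polynomial

section Embedding

variable {K : Type} [Field K] {n : ℕ} {s : Fin n → ℕ} {G : MvPolynomial (Fin n ⊕ Fin 2) K}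

/-- The canonical map `k[X_1,…,X_m,Z,T] → A`. -/
def embA (k : Type) [CommRing k] (m : ℕ) (r : Fin m → ℕ) (F : MvPolynomial (Fin m ⊕ Fin 2) k) :
    MvPolynomial (Fin m ⊕ Fin 2) k →ₐ[k] RingA k m r F :=
  (Ideal.Quotient.mkₐ k _).comp (incl k m)

theorem embA_X_inl (i : Fin n) : embA K n s G (X (Sum.inl i)) = xA K n s G i := by
  simp [embA, incl, xA]

theorem embA_X_inr_zero : embA K n s G (X (Sum.inr 0)) = zA K n s G := by
  simp [embA, incl, zA]

theorem embA_X_inr_one : embA K n s G (X (Sum.inr 1)) = tA K n s G := by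
  simp [embA, incl, tA]

theorem embA_monomialX : embA K n s G (monomialX K s) = ∏ i, xA K n s G i ^ s i := by
  simp [monomialX, embA_X_inl]

theorem embA_monomialX_mul_yA :
    embA K n s G (monomialX K s) * yA K n s G = embA K n s G G := by
  have h : (Ideal.Quotient.mk (Ideal.span {relG K n s G}))
      ((∏ i, X (Sum.inl i) ^ s i) * X (Sum.inr 0) - incl K n G) = 0 :=
    Ideal.Quotient.eq_zero_iff_mem.2 (Ideal.subset_span rfl)
  rw [map_sub, map_mul, map_prod, sub_eq_zero] at h
  simp only [map_pow] at h
  rw [embA_monomialX]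
  exact h

/-- An algebra homomorphism out of `A`, given by its values on the generators. -/
def liftA {D : Type} [CommRing D] [Algebra K D] (g : MvPolynomial (Fin n ⊕ Fin 2) K →ₐ[K] D)
    (d : D) (h : g (monomialX K s) * d = g G) : RingA K n s G →ₐ[K] D :=
  Ideal.Quotient.liftₐ _
    (aeval (Sum.elim (fun i => g (X (Sum.inl i))) (Fin.cons d fun v => g (X (Sum.inr v))))) <| by
    have hincl : (aeval (Sum.elim (fun i => g (X (Sum.inl i)))
        (Fin.cons d fun v => g (X (Sum.inr v))))).comp (incl K n) = g := by
      ext v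
      rcases v with v | v <;> simp [incl]
    intro a ha
    obtain ⟨c, rfl⟩ := Ideal.mem_span_singleton'.1 ha
    have := DFunLike.congr_fun hincl G
    rw [AlgHom.comp_apply] at this
    rw [map_mul, relG, map_sub, this, ← h]
    simp [monomialX]

section lift

variable {D : Type} [CommRing D] [Algebra K D] (g : MvPolynomial (Fin n ⊕ Fin 2) K →ₐ[K] D)
    (d : D) (h : g (monomialX K s) * d = g G)

theorem liftA_mk (p : BigP K n) : liftA g d h (Ideal.Quotient.mk _ p) =
    aeval (Sum.elim (fun i => g (X (Sum.inl i))) (Fin.cons d fun v => g (X (Sum.inr v)))) p :=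
  rfl

theorem liftA_embA (p : MvPolynomial (Fin n ⊕ Fin 2) K) :
    liftA g d h (embA K n s G p) = g p := by
  have : (liftA g d h).comp (embA K n s G) = g := by
    ext v
    rcases v with v | v <;> simp [embA, incl, liftA_mk]
  exact DFunLike.congr_fun this p

theorem liftA_yA : liftA g d h (yA K n s G) = d := by
  simp [yA, liftA_mk]

end lift

theorem embA_injective : Function.Injective (embA K n s G) := by
  let P := MvPolynomial (Fin n ⊕ Fin 2) K
  have hu : algebraMap P (FractionRing P) (monomialX K s) ≠ 0 := by
    simpa using monomialX_ne_zero
  have h : (IsScalarTower.toAlgHom K P (FractionRing P)) (monomialX K s) *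
      ((algebraMap P (FractionRing P) G) / algebraMap P (FractionRing P) (monomialX K s)) =
      (IsScalarTower.toAlgHom K P (FractionRing P)) G := mul_div_cancel₀ _ hu
  intro p q hpq
  have := congrArg (liftA _ _ h) hpq
  rw [liftA_embA, liftA_embA] at this
  exact IsFractionRing.injective P (FractionRing P) this

theorem range_embA : (embA K n s G).range = BA K n s G := by
  rw [← Algebra.map_top, ← MvPolynomial.adjoin_range_X, AlgHom.map_adjoin, BA]
  congr 1
  ext a
  simp only [← Set.range_comp, Set.mem_range, Set.mem_union, Set.mem_insert_iff,
    Set.mem_singleton_iff, Sum.exists, Fin.exists_fin_two, Function.comp_apply, embA_X_inl,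
    embA_X_inr_zero, embA_X_inr_one, eq_comm]

theorem mem_BA_iff {a : RingA K n s G} : a ∈ BA K n s G ↔ ∃ p, embA K n s G p = a := by
  rw [← range_embA, AlgHom.mem_range]

theorem mem_idealUF_iff {a : RingA K n s G} : a ∈ idealUF K n s G ↔
    ∃ b c, embA K n s G (monomialX K s * b + G * c) = a := by
  simp only [idealUF, Set.mem_ofPred_eq, mem_BA_iff, map_add, map_mul, embA_monomialX]
  constructor
  · rintro ⟨_, ⟨b, rfl⟩, _, ⟨c, rfl⟩, rfl⟩
    exact ⟨b, c, rfl⟩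
  · rintro ⟨b, c, rfl⟩
    exact ⟨_, ⟨b, rfl⟩, _, ⟨c, rfl⟩, rfl⟩

theorem adjoin_generators : Algebra.adjoin K
    (Set.range (embA K n s G) ∪ {yA K n s G}) = ⊤ := by
  have hsurj : (Ideal.Quotient.mkₐ K (Ideal.span {relG K n s G})).range = ⊤ :=
    (AlgHom.range_eq_top _).2 (Ideal.Quotient.mkₐ_surjective K _)
  rw [eq_top_iff, ← hsurj, ← Algebra.map_top, ← MvPolynomial.adjoin_range_X, AlgHom.map_adjoin]
  refine Algebra.adjoin_mono ?_
  rintro _ ⟨_, ⟨v, rfl⟩, rfl⟩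
  rcases v with i | v
  · exact Or.inl ⟨X (Sum.inl i), embA_X_inl i⟩
  · refine Fin.cases (Or.inr rfl) (fun v => Or.inl ⟨X (Sum.inr v), ?_⟩) v
    simp [embA, incl]

theorem exists_pow_mul_eq_embA (a : RingA K n s G) :
    ∃ N p, embA K n s G (monomialX K s ^ N) * a = embA K n s G p := by
  have ha : a ∈ Algebra.adjoin K (Set.range (embA K n s G) ∪ {yA K n s G}) := by
    rw [adjoin_generators]; trivial
  induction ha using Algebra.adjoin_induction with
  | mem a ha =>
    rcases ha with ⟨p, rfl⟩ | rfl
    · exact ⟨0, p, by simp⟩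
    · exact ⟨1, G, by rw [pow_one, embA_monomialX_mul_yA]⟩
  | algebraMap c => exact ⟨0, C c, by simp [← MvPolynomial.algebraMap_eq]⟩
  | add a b _ _ ha hb =>
    obtain ⟨N, p, hp⟩ := ha
    obtain ⟨M, q, hq⟩ := hb
    refine ⟨N + M, monomialX K s ^ M * p + monomialX K s ^ N * q, ?_⟩
    rw [map_add, map_mul _ _ p, map_mul _ _ q, ← hp, ← hq, pow_add, map_mul]
    ring
  | mul a b _ _ ha hb =>
    obtain ⟨N, p, hp⟩ := ha
    obtain ⟨M, q, hq⟩ := hb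
    refine ⟨N + M, p * q, ?_⟩
    rw [map_mul _ p, ← hp, ← hq, pow_add, map_mul]
    ring

/-- A homomorphism `g : B → D` killing `X_1^{r_1}⋯X_m^{r_m}` and `F` extends to a homomorphism
`A → D[Y]` sending `y` to `Y`. -/
theorem exists_hom_polynomial {D : Type} [CommRing D] [Algebra K D]
    (g : MvPolynomial (Fin n ⊕ Fin 2) K →ₐ[K] D) (hu : g (monomialX K s) = 0) (hG : g G = 0) :
    ∃ π : RingA K n s G →ₐ[K] Polynomial D,
      (∀ p, π (embA K n s G p) = Polynomial.C (g p)) ∧ π (yA K n s G) = Polynomial.X := by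
  have h : (Polynomial.CAlgHom.comp g) (monomialX K s) * Polynomial.X =
      (Polynomial.CAlgHom.comp g) G := by
    simp [hu, hG]
  exact ⟨liftA _ _ h, fun p => liftA_embA _ _ h p, liftA_yA _ _ h⟩

/-- For `w` dividing `X_1^{r_1}⋯X_m^{r_m}`, a relation `b + c y ∈ wA` with `b, c ∈ B` forces
`b, c ∈ (w, F)B`. -/
theorem mem_span_of_embA_add_embA_mul_yA {w p q : MvPolynomial (Fin n ⊕ Fin 2) K}
    (hw : w ∣ monomialX K s) {a : RingA K n s G}
    (h : embA K n s G p + embA K n s G q * yA K n s G = embA K n s G w * a) :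
    p ∈ Ideal.span {w, G} ∧ q ∈ Ideal.span {w, G} := by
  have hwI : w ∈ Ideal.span {w, G} := Ideal.subset_span (by simp)
  have hGI : G ∈ Ideal.span {w, G} := Ideal.subset_span (by simp)
  obtain ⟨π, hπ, hy⟩ := exists_hom_polynomial (s := s) (G := G)
    (Ideal.Quotient.mkₐ K (Ideal.span {w, G}))
    (Ideal.Quotient.eq_zero_iff_mem.2 (Ideal.mem_of_dvd _ hw hwI))
    (Ideal.Quotient.eq_zero_iff_mem.2 hGI)
  have h' := congrArg π h
  rw [map_add, map_mul, map_mul, hπ, hπ, hπ, hy,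
    show Ideal.Quotient.mkₐ K (Ideal.span {w, G}) w = 0 from
      Ideal.Quotient.eq_zero_iff_mem.2 hwI, map_zero, zero_mul] at h'
  constructor
  · simpa [Ideal.Quotient.eq_zero_iff_mem] using congrArg (Polynomial.coeff · 0) h'
  · simpa [Ideal.Quotient.eq_zero_iff_mem] using congrArg (Polynomial.coeff · 1) h'

theorem exists_eq_of_embA_eq_mul {w p : MvPolynomial (Fin n ⊕ Fin 2) K}
    (hw : w ∣ monomialX K s) {a : RingA K n s G} (h : embA K n s G p = embA K n s G w * a) :
    ∃ b c, p = w * b + G * c := by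
  have := (mem_span_of_embA_add_embA_mul_yA (q := 0) hw (by simpa using h)).1
  obtain ⟨b, c, h'⟩ := Ideal.mem_span_pair.1 this
  exact ⟨b, c, by rw [← h']; ring⟩

theorem mem_idealUF_iff_dvd {a : RingA K n s G} : a ∈ idealUF K n s G ↔
    a ∈ BA K n s G ∧ embA K n s G (monomialX K s) ∣ a := by
  rw [mem_idealUF_iff, mem_BA_iff]
  constructor
  · rintro ⟨b, c, rfl⟩
    refine ⟨⟨_, rfl⟩, embA K n s G b + yA K n s G * embA K n s G c, ?_⟩
    rw [map_add, map_mul, map_mul _ G, ← embA_monomialX_mul_yA]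
    ring
  · rintro ⟨⟨p, rfl⟩, d, hd⟩
    obtain ⟨b, c, rfl⟩ := exists_eq_of_embA_eq_mul dvd_rfl hd
    exact ⟨b, c, rfl⟩

end Embedding

section Derksen

/-- Coefficientwise application of `e` commutes with `φ_V ∘ φ_U`, as needed to conjugate an
exponential map by an algebra isomorphism. -/
theorem ExpMap.map_eval₂_comp {R S : Type} [CommRing R] [CommRing S] (e : R →+* S)
    (f : R →+* Polynomial (Polynomial R)) (g : S →+* Polynomial (Polynomial S))
    (hfg : ∀ a, g (e a) = Polynomial.map (Polynomial.mapRingHom e) (f a))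
    (b : Polynomial (Polynomial R)) (p : Polynomial R) :
    Polynomial.eval₂ g (Polynomial.map (Polynomial.mapRingHom e) b) (Polynomial.map e p) =
      Polynomial.map (Polynomial.mapRingHom e) (Polynomial.eval₂ f b p) := by
  rw [Polynomial.eval₂_map, ← Polynomial.coe_mapRingHom, Polynomial.hom_eval₂]
  congr 1
  ext1 a
  exact hfg a

variable {k D : Type} [CommRing k] [CommRing D] [Algebra k D]

/-- The conjugate of an exponential map by an automorphism. -/
def ExpMap.conj (ψ : ExpMap k D) (e : D ≃ₐ[k] D) : ExpMap k D where
  toAlgHom := ((Polynomial.mapAlgHom (e : D →ₐ[k] D)).comp ψ.toAlgHom).comp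
    (e.symm : D →ₐ[k] D)
  eval_zero d := by
    change Polynomial.eval 0 (Polynomial.map (e : D →+* D) (ψ.toAlgHom (e.symm d))) = d
    rw [Polynomial.eval_zero_map, ψ.eval_zero]
    exact e.apply_symm_apply d
  comp_add d := by
    have h := congrArg (Polynomial.map (Polynomial.mapRingHom (e : D →+* D)))
      (ψ.comp_add (e.symm d))
    rw [← ExpMap.map_eval₂_comp _ _ ((Polynomial.mapRingHom (Polynomial.C (R := D))).comp
        (((Polynomial.mapAlgHom (e : D →ₐ[k] D)).comp ψ.toAlgHom).comp
          (e.symm : D →ₐ[k] D)).toRingHom),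
      ← ExpMap.map_eval₂_comp _ _ ((Polynomial.C (R := Polynomial D)).comp
        (Polynomial.C (R := D)))] at h
    · simpa using h
    · intro a
      simp
    · intro a
      change Polynomial.map Polynomial.C
        (Polynomial.map (e : D →+* D) (ψ.toAlgHom (e.symm (e a)))) =
        Polynomial.map (Polynomial.mapRingHom (e : D →+* D))
          (Polynomial.map Polynomial.C (ψ.toAlgHom a))
      rw [AlgEquiv.symm_apply_apply, Polynomial.map_map, Polynomial.map_map]
      congr 1
      ext1 b
      simp

theorem ExpMap.map_mem_conj_invariants (ψ : ExpMap k D) (e : D ≃ₐ[k] D) {a : D} :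
    e a ∈ (ψ.conj e).invariants ↔ a ∈ ψ.invariants := by
  change Polynomial.map (e : D →+* D) (ψ.toAlgHom (e.symm (e a))) = Polynomial.C (e a) ↔
    ψ.toAlgHom a = Polynomial.C a
  rw [AlgEquiv.symm_apply_apply]
  have : Polynomial.C (e a) = Polynomial.map (e : D →+* D) (Polynomial.C a) := by simp
  rw [this, (Polynomial.map_injective (e : D →+* D) e.injective).eq_iff]

theorem map_mem_Derksen (e : D ≃ₐ[k] D) {a : D} (ha : a ∈ Derksen k D) : e a ∈ Derksen k D := by
  suffices Derksen k D ≤ (Derksen k D).comap (e : D →ₐ[k] D) from this ha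
  refine Algebra.adjoin_le fun b hb => ?_
  simp only [Set.mem_iUnion, exists_prop] at hb
  obtain ⟨ψ, hψ, hb⟩ := hb
  refine Algebra.subset_adjoin ?_
  simp only [Set.mem_iUnion, exists_prop]
  refine ⟨ψ.conj e, fun h => hψ ?_, (ψ.map_mem_conj_invariants e).2 hb⟩
  rw [eq_top_iff]
  intro c _
  rw [← ψ.map_mem_conj_invariants e, h]
  trivial

theorem bijOn_Derksen (e : D ≃ₐ[k] D) : Set.BijOn e (Derksen k D) (Derksen k D) :=
  ⟨fun _ => map_mem_Derksen e, e.injective.injOn, fun a ha =>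
    ⟨e.symm a, map_mem_Derksen e.symm ha, e.apply_symm_apply a⟩⟩

theorem ExpMap.isUnit_mem_invariants [IsDomain D] (ψ : ExpMap k D) {a : D} (ha : IsUnit a) :
    a ∈ ψ.invariants := by
  obtain ⟨c, -, hc⟩ := Polynomial.isUnit_iff.1 (ha.map ψ.toAlgHom)
  have h := ψ.eval_zero a
  rw [← hc, Polynomial.eval_C] at h
  exact (h ▸ hc).symm

theorem isUnit_mem_Derksen [IsDomain D] {a : D} (hD : ∃ ψ : ExpMap k D, ψ.invariants ≠ ⊤)
    (ha : IsUnit a) : a ∈ Derksen k D := by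
  obtain ⟨ψ, hψ⟩ := hD
  refine Algebra.subset_adjoin ?_
  simp only [Set.mem_iUnion, exists_prop]
  exact ⟨ψ, hψ, ψ.isUnit_mem_invariants ha⟩

theorem Derksen_eq_bot_of_forall (hD : ∀ ψ : ExpMap k D, ψ.invariants = ⊤) :
    Derksen k D = ⊥ := by
  rw [Derksen, eq_bot_iff]
  refine Algebra.adjoin_le fun b hb => ?_
  simp only [Set.mem_iUnion, exists_prop] at hb
  obtain ⟨ψ, hψ, -⟩ := hb
  exact absurd (hD ψ) hψ

end Derksen

section Automorphisms

variable {K : Type} [Field K] {n : ℕ} {s : Fin n → ℕ} {G : MvPolynomial (Fin n ⊕ Fin 2) K}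

theorem not_isUnit_xA_of_Derksen_eq [IsDomain (RingA K n s G)]
    (hDK : Derksen K (RingA K n s G) = BA K n s G) (i : Fin n) : ¬ IsUnit (xA K n s G i) := by
  intro hx
  have hXB : xA K n s G i ∈ BA K n s G := mem_BA_iff.2 ⟨_, embA_X_inl i⟩
  by_cases hD : ∃ ψ : ExpMap K (RingA K n s G), ψ.invariants ≠ ⊤
  · obtain ⟨b, hb⟩ := hx.exists_right_inv
    have hbB : b ∈ BA K n s G := hDK ▸ isUnit_mem_Derksen hD (IsUnit.of_mul_eq_one_right _ hb)
    obtain ⟨p, rfl⟩ := mem_BA_iff.1 hbB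
    rw [← embA_X_inl, ← map_mul, ← map_one (embA K n s G)] at hb
    exact X_prime.not_isUnit (IsUnit.of_mul_eq_one _ (embA_injective hb))
  · push Not at hD
    rw [← hDK, Derksen_eq_bot_of_forall hD, Algebra.mem_bot] at hXB
    obtain ⟨c, hc⟩ := hXB
    rw [← embA_X_inl, ← AlgHom.commutes (embA K n s G) c] at hc
    have hc' := embA_injective hc
    have h0 : c = 0 := by simpa using congrArg (aeval (fun _ => (0 : K))) hc'
    exact X_ne_zero _ (by rw [← hc', h0, map_zero] : (X (Sum.inl i) :
      MvPolynomial (Fin n ⊕ Fin 2) K) = 0)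

/-- When `x_i` is not a unit of `A`, monomials in the other `x_l` avoid the ideal `(x_i, F)B`. -/
theorem prod_erase_notMem_span (hf : fOf K n G ≠ 0) {i : Fin n} (hi : s i ≠ 0)
    (hx : ¬ IsUnit (xA K n s G i)) (e : Fin n → ℕ) :
    ∏ l ∈ Finset.univ.erase i, X (Sum.inl l) ^ e l ∉ Ideal.span {X (Sum.inl i), G} := by
  intro h
  obtain ⟨a, b, hab⟩ := Ideal.mem_span_pair.1 h
  obtain ⟨c, hc, g, hg⟩ := exists_eq_C_add_X_mul (s := e) hf (i := i) (a := a) (b := b)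
    (by rw [← hab]; ring)
  obtain ⟨v, hv⟩ := X_dvd_monomialX (K := K) hi
  have key : embA K n s G (C c) =
      xA K n s G i * (embA K n s G v * yA K n s G - embA K n s G g) := by
    have h1 := embA_monomialX_mul_yA (K := K) (s := s) (G := G)
    have h2 := congrArg (embA K n s G) hg
    rw [hv, map_mul, embA_X_inl, h2, map_add, map_mul, embA_X_inl] at h1
    linear_combination -h1
  have hu : IsUnit (embA K n s G (C c)) := (hc.isUnit.map C).map _
  exact hx (isUnit_of_dvd_unit ⟨_, key⟩ hu)

/-- The exponents of a monomial in `x_1,…,x_m` lying in `I` are at least the `r_i`. -/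
theorem le_of_monomialX_mem_span (hf : fOf K n G ≠ 0) {i : Fin n}
    (hx : ¬ IsUnit (xA K n s G i)) {e : Fin n → ℕ}
    (h : monomialX K e ∈ Ideal.span {monomialX K s, G}) : s i ≤ e i := by
  by_contra! hlt
  obtain ⟨a, b, hab⟩ := Ideal.mem_span_pair.1 h
  obtain ⟨d, hd⟩ := Nat.exists_eq_add_of_lt hlt
  rw [monomialX_eq_X_pow_mul i, monomialX_eq_X_pow_mul (s := e) i, hd] at hab
  have hdvd : (X (Sum.inl i) ^ e i : MvPolynomial (Fin n ⊕ Fin 2) K) ∣ G * b := by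
    rw [← eq_sub_iff_add_eq'] at hab
    rw [mul_comm, hab]
    refine dvd_sub (dvd_mul_right _ _) ?_
    rw [add_assoc, pow_add]
    exact ((dvd_mul_right _ _).mul_right _).mul_left _
  obtain ⟨c, rfl⟩ :=
    ((isRelPrime_X_of_fOf_ne_zero hf i).pow_right.symm).dvd_of_dvd_mul_left hdvd
  refine prod_erase_notMem_span hf (by omega) hx e (Ideal.mem_span_pair.2
    ⟨a * (X (Sum.inl i) ^ d * ∏ l ∈ Finset.univ.erase i, X (Sum.inl l) ^ s l), c, ?_⟩)
  refine mul_left_cancel₀ (pow_ne_zero (e i) (X_ne_zero (Sum.inl i))) ?_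
  rw [← hab]
  ring

/-- When `x_i` is not a unit of `A`, `F` does not lie in `x_i B + (x_i^{r_i + 1}A ∩ B)`. -/
theorem embA_ne_of_eq_X_mul_add [IsDomain (RingA K n s G)] (hf : fOf K n G ≠ 0) {i : Fin n}
    (hi : s i ≠ 0) (hx : ¬ IsUnit (xA K n s G i)) {b c : MvPolynomial (Fin n ⊕ Fin 2) K}
    (hG : G = X (Sum.inl i) * c + b) (a : RingA K n s G) :
    embA K n s G b ≠ embA K n s G (X (Sum.inl i) ^ (s i + 1)) * a := by
  intro h
  obtain ⟨p, q, rfl⟩ := exists_eq_of_embA_eq_mul (w := X (Sum.inl i) ^ s i)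
    (X_pow_dvd_monomialX i) (a := xA K n s G i * a)
    (by rw [h, pow_succ, map_mul, embA_X_inl]; ring)
  set w : MvPolynomial (Fin n ⊕ Fin 2) K := ∏ l ∈ Finset.univ.erase i, X (Sum.inl l) ^ s l
  have hw : monomialX K s = X (Sum.inl i) ^ s i * w := monomialX_eq_X_pow_mul i
  have hXi : embA K n s G (X (Sum.inl i) ^ s i) ≠ 0 := by
    rw [Ne, map_eq_zero_iff _ embA_injective]
    exact pow_ne_zero _ (X_ne_zero _)
  have hrel : embA K n s G p + embA K n s G (w * q) * yA K n s G =
      embA K n s G (X (Sum.inl i)) * a := by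
    refine mul_left_cancel₀ hXi ?_
    have h1 := embA_monomialX_mul_yA (K := K) (s := s) (G := G)
    rw [hw, map_mul] at h1
    rw [map_add, map_mul, map_mul _ G, ← h1, pow_succ, map_mul] at h
    rw [map_mul]
    linear_combination h
  have hwq := (mem_span_of_embA_add_embA_mul_yA (X_dvd_monomialX hi) hrel).2
  obtain ⟨t, ht⟩ := Nat.exists_eq_succ_of_ne_zero hi
  have hq : (X (Sum.inl i) : MvPolynomial (Fin n ⊕ Fin 2) K) ∣ 1 - q := by
    refine (isRelPrime_X_of_fOf_ne_zero hf i).symm.dvd_of_dvd_mul_left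
      (y := G) ⟨c + X (Sum.inl i) ^ t * p, ?_⟩
    rw [ht, pow_succ] at hG
    linear_combination hG
  obtain ⟨d, hd⟩ := hq
  refine prod_erase_notMem_span hf hi hx s ?_
  have : w = w * q + w * d * X (Sum.inl i) := by linear_combination w * hd
  change w ∈ _
  rw [this]
  exact add_mem hwq (Ideal.mul_mem_left _ _ (Ideal.subset_span (by simp)))

/-- An endomorphism of `A` restricting to an automorphism of `B` is induced on `B` by an
automorphism of the polynomial ring `k[X_1,…,X_m,Z,T]`. -/
theorem exists_algEquiv_of_bijOn (φ : RingA K n s G →ₐ[K] RingA K n s G)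
    (hφ : Set.BijOn φ (BA K n s G) (BA K n s G)) :
    ∃ β : MvPolynomial (Fin n ⊕ Fin 2) K ≃ₐ[K] MvPolynomial (Fin n ⊕ Fin 2) K,
      ∀ p, φ (embA K n s G p) = embA K n s G (β p) := by
  have hmem (p) : embA K n s G p ∈ BA K n s G := mem_BA_iff.2 ⟨p, rfl⟩
  have hX (v) : ∃ q, embA K n s G q = φ (embA K n s G (X v)) :=
    mem_BA_iff.1 (hφ.mapsTo (hmem _))
  choose q hq using hX
  have hβ (p) : φ (embA K n s G p) = embA K n s G (aeval q p) := by
    have : φ.comp (embA K n s G) = (embA K n s G).comp (aeval q) := by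
      ext v
      simp [hq]
    exact DFunLike.congr_fun this p
  refine ⟨AlgEquiv.ofBijective (aeval q) ⟨fun a b hab => embA_injective
    (hφ.injOn (hmem _) (hmem _) ?_), fun a => ?_⟩, hβ⟩
  · rw [hβ, hβ, hab]
  · obtain ⟨b, hb, hba⟩ := hφ.surjOn (hmem a)
    obtain ⟨p, rfl⟩ := mem_BA_iff.1 hb
    exact ⟨p, embA_injective (by rw [← hba, hβ])⟩

theorem exists_perm (hs : ∀ i, s i ≠ 0) (hf : fOf K n G ≠ 0)
    (φ : RingA K n s G →ₐ[K] RingA K n s G)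
    (β : MvPolynomial (Fin n ⊕ Fin 2) K ≃ₐ[K] MvPolynomial (Fin n ⊕ Fin 2) K)
    (hβ : ∀ p, φ (embA K n s G p) = embA K n s G (β p)) :
    ∃ (σ : Equiv.Perm (Fin n)) (c : Fin n → K), (∀ i, c i ≠ 0) ∧
      ∀ i, β (X (Sum.inl i)) = C (c i) * X (Sum.inl (σ i)) := by
  obtain ⟨N, b, hb⟩ := exists_pow_mul_eq_embA (φ (yA K n s G))
  have hy := congrArg φ (embA_monomialX_mul_yA (K := K) (s := s) (G := G))
  rw [map_mul, hβ, hβ] at hy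
  have hdvd : β (monomialX K s) ∣ β G * monomialX K s ^ N := by
    refine ⟨b, embA_injective (s := s) (G := G) ?_⟩
    rw [map_mul, map_mul, ← hb, ← hy]
    ring
  have hrel : IsRelPrime (β (monomialX K s)) (β G) := by
    refine IsRelPrime.of_map β.symm ?_
    simpa using (isRelPrime_monomialX_of_fOf_ne_zero (s := s) hf).symm
  replace hdvd := hrel.dvd_of_dvd_mul_left hdvd
  have hprime (i : Fin n) : Prime (β (X (Sum.inl i))) :=
    (MulEquiv.prime_iff β).2 X_prime
  have hex (i : Fin n) : ∃ j : Fin n, ∃ c : K, c ≠ 0 ∧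
      β (X (Sum.inl i)) = C c * X (Sum.inl j) := by
    have h1 : β (X (Sum.inl i)) ∣ monomialX K s :=
      (hprime i).dvd_of_dvd_pow (((map_dvd β (X_dvd_monomialX (hs i)))).trans hdvd)
    obtain ⟨j, -, hj⟩ := (hprime i).exists_mem_finset_dvd h1
    have hj' := (hprime i).dvd_of_dvd_pow hj
    obtain ⟨u, hu⟩ := ((hprime i).irreducible.associated_of_dvd X_prime.irreducible hj').symm
    obtain ⟨c, hc, hcu⟩ := MvPolynomial.isUnit_iff_eq_C_of_isReduced.1 u.isUnit
    exact ⟨j, c, hc.ne_zero, by rw [← hu, hcu, mul_comm]⟩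
  choose σ c hc hσ using hex
  have hinj : Function.Injective σ := by
    intro i j hij
    have h : β (C (c j) * X (Sum.inl i)) = β (C (c i) * X (Sum.inl j)) := by
      rw [map_mul, map_mul, hσ, hσ, hij, ← MvPolynomial.algebraMap_eq, AlgEquiv.commutes,
        AlgEquiv.commutes]
      ring
    have h' := congrArg (aeval fun v => if v = Sum.inl i then (1 : K) else 0) (β.injective h)
    by_contra hne
    simp [Ne.symm hne, hc j] at h'
  exact ⟨Equiv.ofBijective σ (Finite.injective_iff_bijective.1 hinj), c, hc, hσ⟩

theorem bijOn_EA (φ : RingA K n s G →ₐ[K] RingA K n s G)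
    (hinj : Set.InjOn φ (BA K n s G)) (σ : Equiv.Perm (Fin n)) {c : Fin n → K}
    (hc : ∀ i, c i ≠ 0)
    (hσ : ∀ i, φ (xA K n s G i) = algebraMap K _ (c i) * xA K n s G (σ i)) :
    Set.BijOn φ (EA K n s G) (EA K n s G) := by
  have hle : EA K n s G ≤ BA K n s G := Algebra.adjoin_mono Set.subset_union_left
  have hx (i) : xA K n s G i ∈ EA K n s G := Algebra.subset_adjoin ⟨i, rfl⟩
  have hmap : (EA K n s G).map φ = EA K n s G := by
    rw [EA, AlgHom.map_adjoin]
    refine le_antisymm (Algebra.adjoin_le ?_) (Algebra.adjoin_le ?_)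
    · rintro _ ⟨_, ⟨i, rfl⟩, rfl⟩
      rw [hσ]
      exact mul_mem (algebraMap_mem _ _) (hx _)
    · rintro _ ⟨i, rfl⟩
      have h : xA K n s G i = algebraMap K _ (c (σ.symm i))⁻¹ * φ (xA K n s G (σ.symm i)) := by
        rw [hσ, ← mul_assoc, ← map_mul, inv_mul_cancel₀ (hc _), map_one, one_mul,
          Equiv.apply_symm_apply]
      rw [h]
      exact mul_mem (algebraMap_mem _ _) (Algebra.subset_adjoin ⟨_, ⟨_, rfl⟩, rfl⟩)
  have himg : φ '' (EA K n s G) = EA K n s G := by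
    rw [← Subalgebra.coe_map, hmap]
  exact ⟨Set.mapsTo_iff_image_subset.2 himg.le, hinj.mono hle, himg.ge⟩

theorem map_monomialX_eq_C_mul
    (β : MvPolynomial (Fin n ⊕ Fin 2) K ≃ₐ[K] MvPolynomial (Fin n ⊕ Fin 2) K)
    (σ : Equiv.Perm (Fin n)) {c : Fin n → K}
    (hσ : ∀ i, β (X (Sum.inl i)) = C (c i) * X (Sum.inl (σ i))) :
    β (monomialX K s) = C (∏ i, c i ^ s i) * monomialX K (s ∘ σ.symm) := by
  simp only [monomialX, map_prod, map_pow, hσ, mul_pow, Finset.prod_mul_distrib]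
  congr 1
  exact Fintype.prod_equiv σ _ _ fun i => by simp

theorem comp_perm_eq_of_le {ι : Type} [Fintype ι] {s : ι → ℕ} (σ : Equiv.Perm ι)
    (h : ∀ i, s (σ i) ≤ s i) (i : ι) : s i = s (σ i) :=
  (((Finset.sum_eq_sum_iff_of_le fun i _ => h i).1 (Equiv.sum_comp σ s)) i
    (Finset.mem_univ i)).symm

theorem comp_perm_eq_of_algEquiv [IsDomain (RingA K n s G)] (hs : ∀ i, s i ≠ 0)
    (hf : fOf K n G ≠ 0) (hx : ∀ i, ¬ IsUnit (xA K n s G i))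
    (φ : RingA K n s G ≃ₐ[K] RingA K n s G)
    (β : MvPolynomial (Fin n ⊕ Fin 2) K ≃ₐ[K] MvPolynomial (Fin n ⊕ Fin 2) K)
    (hβ : ∀ p, φ (embA K n s G p) = embA K n s G (β p))
    (σ : Equiv.Perm (Fin n)) {c : Fin n → K} (hc : ∀ i, c i ≠ 0)
    (hσ : ∀ i, β (X (Sum.inl i)) = C (c i) * X (Sum.inl (σ i))) (i : Fin n) :
    s i = s (σ i) := by
  refine comp_perm_eq_of_le σ (fun i => ?_) i
  by_contra! hlt
  have hβ' (p) : φ.symm (embA K n s G p) = embA K n s G (β.symm p) := by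
    rw [AlgEquiv.symm_apply_eq, hβ, AlgEquiv.apply_symm_apply]
  have hσ' : β.symm (X (Sum.inl (σ i))) = C (c i)⁻¹ * X (Sum.inl i) := by
    rw [AlgEquiv.symm_apply_eq, map_mul, hσ, ← MvPolynomial.algebraMap_eq, AlgEquiv.commutes,
      ← mul_assoc, ← map_mul, inv_mul_cancel₀ (hc i), map_one, one_mul]
  have hdvd (j : Fin n) (t : ℕ) (ht : t ≤ s j) :
      embA K n s G (X (Sum.inl j)) ^ t ∣ embA K n s G G := by
    rw [← embA_monomialX_mul_yA, ← map_pow]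
    exact (map_dvd _ ((pow_dvd_pow _ ht).trans (X_pow_dvd_monomialX j))).mul_right _
  obtain ⟨a, ha⟩ := map_dvd φ (hdvd i 1 (Nat.one_le_iff_ne_zero.2 (hs i)))
  rw [pow_one, hβ, hβ, hσ, mul_comm (C _), map_mul, mul_assoc] at ha
  obtain ⟨p, q, hpq⟩ := exists_eq_of_embA_eq_mul (X_dvd_monomialX (hs (σ i))) ha
  obtain ⟨a', ha'⟩ := map_dvd φ.symm (hdvd (σ i) (s i + 1) hlt)
  rw [map_pow, hβ', hβ', hσ', mul_comm (C _), map_mul, mul_pow, mul_assoc, ← map_pow] at ha'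
  have hG := congrArg β.symm hpq
  rw [AlgEquiv.symm_apply_apply, map_add, map_mul, map_mul, hσ'] at hG
  refine embA_ne_of_eq_X_mul_add hf (hs i) (hx i)
    (c := C (c i)⁻¹ * β.symm p) (b := β.symm G * β.symm q) (hG.trans (by ring))
    (embA K n s G (C (c i)⁻¹) ^ (s i + 1) * a' * embA K n s G (β.symm q)) ?_
  rw [map_mul, ha']
  ring

theorem comp_perm_eq_of_image_idealUF (hf : fOf K n G ≠ 0)
    (hx : ∀ i, ¬ IsUnit (xA K n s G i)) (ψ : RingA K n s G →ₐ[K] RingA K n s G)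
    (hI : ψ '' idealUF K n s G = idealUF K n s G)
    (β : MvPolynomial (Fin n ⊕ Fin 2) K ≃ₐ[K] MvPolynomial (Fin n ⊕ Fin 2) K)
    (hβ : ∀ p, ψ (embA K n s G p) = embA K n s G (β p))
    (σ : Equiv.Perm (Fin n)) {c : Fin n → K} (hc : ∀ i, c i ≠ 0)
    (hσ : ∀ i, β (X (Sum.inl i)) = C (c i) * X (Sum.inl (σ i))) (i : Fin n) :
    s i = s (σ i) := by
  refine comp_perm_eq_of_le σ (fun i => ?_) i
  have hu : embA K n s G (monomialX K s) ∈ idealUF K n s G :=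
    mem_idealUF_iff.2 ⟨1, 0, by simp⟩
  have hψu := hI ▸ Set.mem_image_of_mem ψ hu
  rw [hβ, map_monomialX_eq_C_mul β σ hσ, mem_idealUF_iff] at hψu
  obtain ⟨b, b', hb⟩ := hψu
  have hd : IsUnit (C (∏ i, c i ^ s i) : MvPolynomial (Fin n ⊕ Fin 2) K) :=
    (Finset.prod_ne_zero_iff.2 fun i _ => pow_ne_zero (s i) (hc i)).isUnit.map C
  have hmem : monomialX K (s ∘ σ.symm) ∈ Ideal.span {monomialX K s, G} := by
    rw [← Ideal.unit_mul_mem_iff_mem _ hd, Ideal.mem_span_pair]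
    exact ⟨b, b', by rw [← embA_injective hb]; ring⟩
  simpa using le_of_monomialX_mem_span hf (hx (σ i)) hmem

theorem map_xA_of_map_X (φ : RingA K n s G →ₐ[K] RingA K n s G)
    (β : MvPolynomial (Fin n ⊕ Fin 2) K ≃ₐ[K] MvPolynomial (Fin n ⊕ Fin 2) K)
    (hβ : ∀ p, φ (embA K n s G p) = embA K n s G (β p))
    (σ : Equiv.Perm (Fin n)) {c : Fin n → K}
    (hσ : ∀ i, β (X (Sum.inl i)) = C (c i) * X (Sum.inl (σ i))) (i : Fin n) :
    φ (xA K n s G i) = algebraMap K _ (c i) * xA K n s G (σ i) := by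
  rw [← embA_X_inl, hβ, hσ, map_mul, ← MvPolynomial.algebraMap_eq, AlgHom.commutes, embA_X_inl]

theorem map_monomialX_eq_C_mul_self
    (β : MvPolynomial (Fin n ⊕ Fin 2) K ≃ₐ[K] MvPolynomial (Fin n ⊕ Fin 2) K)
    (σ : Equiv.Perm (Fin n)) {c : Fin n → K}
    (hσ : ∀ i, β (X (Sum.inl i)) = C (c i) * X (Sum.inl (σ i))) (hsσ : ∀ i, s i = s (σ i)) :
    β (monomialX K s) = C (∏ i, c i ^ s i) * monomialX K s := by
  have : s ∘ σ.symm = s := by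
    ext i
    simp [hsσ (σ.symm i)]
  rw [map_monomialX_eq_C_mul β σ hσ, this]

theorem image_idealUF_of_algEquiv (φ : RingA K n s G ≃ₐ[K] RingA K n s G)
    (hφ : Set.BijOn φ (BA K n s G) (BA K n s G)) {d : K} (hd : d ≠ 0)
    (hu : φ (embA K n s G (monomialX K s)) = embA K n s G (C d * monomialX K s)) :
    φ '' idealUF K n s G = idealUF K n s G := by
  have hB (a) : φ a ∈ BA K n s G ↔ a ∈ BA K n s G := by
    refine ⟨fun ha => ?_, fun ha => hφ.mapsTo ha⟩
    obtain ⟨b, hb, hba⟩ := hφ.surjOn ha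
    exact φ.injective hba ▸ hb
  have hmem (a) : φ a ∈ idealUF K n s G ↔ a ∈ idealUF K n s G := by
    rw [mem_idealUF_iff_dvd, mem_idealUF_iff_dvd, hB,
      ← map_dvd_iff φ (a := embA K n s G (monomialX K s)) (b := a), hu, map_mul,
      IsUnit.mul_left_dvd ((hd.isUnit.map C).map _)]
  ext b
  constructor
  · rintro ⟨a, ha, rfl⟩
    exact (hmem a).2 ha
  · intro hb
    exact ⟨φ.symm b, (hmem _).1 (by simpa using hb), by simp⟩

theorem bijective_of_image_idealUF [IsDomain (RingA K n s G)]
    (ψ : RingA K n s G →ₐ[K] RingA K n s G)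
    (hψ : Set.BijOn ψ (BA K n s G) (BA K n s G))
    (hI : ψ '' idealUF K n s G = idealUF K n s G) {d : K}
    (hu : ψ (embA K n s G (monomialX K s)) = embA K n s G (C d * monomialX K s)) :
    Function.Bijective ψ := by
  have hu0 : embA K n s G (monomialX K s) ≠ 0 := by
    rw [Ne, map_eq_zero_iff _ embA_injective]
    exact monomialX_ne_zero
  constructor
  · rw [injective_iff_map_eq_zero]
    intro a ha
    obtain ⟨N, p, hp⟩ := exists_pow_mul_eq_embA a
    have h0 : embA K n s G p = 0 := by
      refine hψ.injOn (mem_BA_iff.2 ⟨p, rfl⟩) (zero_mem _) ?_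
      rw [← hp, map_mul, ha, mul_zero, map_zero]
    rw [h0, map_pow] at hp
    exact (mul_eq_zero.1 hp).resolve_left (pow_ne_zero _ hu0)
  · have hBr : ∀ p, embA K n s G p ∈ ψ.range := fun p => by
      obtain ⟨a, -, ha⟩ := hψ.surjOn (mem_BA_iff.2 ⟨p, rfl⟩)
      exact ⟨a, ha⟩
    have hy : yA K n s G ∈ ψ.range := by
      have hG : embA K n s G G ∈ idealUF K n s G := mem_idealUF_iff.2 ⟨0, 1, by simp⟩
      rw [← hI] at hG
      obtain ⟨a, ha, haG⟩ := hG
      obtain ⟨b, rfl⟩ := (mem_idealUF_iff_dvd.1 ha).2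
      refine ⟨algebraMap K _ d * b, mul_left_cancel₀ hu0 ?_⟩
      rw [map_mul, hu, map_mul, ← MvPolynomial.algebraMap_eq, AlgHom.commutes] at haG
      change _ * ψ _ = _
      rw [map_mul, AlgHom.commutes, embA_monomialX_mul_yA, ← haG]
      ring
    rw [← Set.range_eq_univ, ← AlgHom.coe_range, ← Algebra.coe_top (R := K), SetLike.coe_set_eq,
      eq_top_iff, ← adjoin_generators]
    refine Algebra.adjoin_le ?_
    rintro _ (⟨p, rfl⟩ | rfl)
    · exact hBr p
    · exact hy

end Automorphisms

theorem statement16 (k : Type) [Field k] (m : ℕ) (hm : 1 ≤ m)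
    (r : Fin m → ℕ) (hr : ∀ i, 1 < r i)
    (F : MvPolynomial (Fin m ⊕ Fin 2) k) (hf : fOf k m F ≠ 0)
    [IsDomain (RingA k m r F)]
    (hFh : F - rename Sum.inr (fOf k m F) ∈
      Ideal.span (Set.range fun i : Fin m =>
        (X (Sum.inl i) : MvPolynomial (Fin m ⊕ Fin 2) k)))
    (hDK : Derksen k (RingA k m r F) = BA k m r F) :
    (∀ φ : RingA k m r F ≃ₐ[k] RingA k m r F,
      (Set.BijOn ⇑φ ↑(EA k m r F) ↑(EA k m r F) ∧
        Set.BijOn ⇑φ ↑(BA k m r F) ↑(BA k m r F)) ∧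
      (∀ i : Fin m, ∃ j : Fin m, ∃ lam : k, lam ≠ 0 ∧
        φ (xA k m r F i) = algebraMap k (RingA k m r F) lam * xA k m r F j ∧
        r i = r j) ∧
      ⇑φ '' idealUF k m r F = idealUF k m r F) ∧
    (∀ ψ : RingA k m r F →ₐ[k] RingA k m r F,
      (Set.BijOn ⇑ψ ↑(EA k m r F) ↑(EA k m r F) ∧
        Set.BijOn ⇑ψ ↑(BA k m r F) ↑(BA k m r F)) →
      ⇑ψ '' idealUF k m r F = idealUF k m r F →
      (∀ i : Fin m, ∃ j : Fin m, ∃ lam : k, lam ≠ 0 ∧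
        ψ (xA k m r F i) = algebraMap k (RingA k m r F) lam * xA k m r F j ∧
        r i = r j) ∧
      Function.Bijective ⇑ψ) := by
  have hs (i) : r i ≠ 0 := (zero_lt_one.trans (hr i)).ne'
  have hx := not_isUnit_xA_of_Derksen_eq hDK
  refine ⟨fun φ => ?_, fun ψ ⟨_, hB⟩ hI => ?_⟩
  · have hB : Set.BijOn φ (BA k m r F) (BA k m r F) := hDK ▸ bijOn_Derksen φ
    obtain ⟨β, hβ⟩ := exists_algEquiv_of_bijOn (φ : RingA k m r F →ₐ[k] RingA k m r F) hB
    obtain ⟨σ, c, hc, hσ⟩ := exists_perm hs hf _ β hβ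
    have hrσ := comp_perm_eq_of_algEquiv hs hf hx φ β hβ σ hc hσ
    have hφx := map_xA_of_map_X _ β hβ σ hσ
    refine ⟨⟨bijOn_EA _ hB.injOn σ hc hφx, hB⟩, fun i => ⟨σ i, c i, hc i, hφx i, hrσ i⟩,
      image_idealUF_of_algEquiv φ hB
        (Finset.prod_ne_zero_iff.2 fun i _ => pow_ne_zero (r i) (hc i))
        ((hβ _).trans (congrArg _ (map_monomialX_eq_C_mul_self β σ hσ hrσ)))⟩
  · obtain ⟨β, hβ⟩ := exists_algEquiv_of_bijOn ψ hB
    obtain ⟨σ, c, hc, hσ⟩ := exists_perm hs hf ψ β hβ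
    have hrσ := comp_perm_eq_of_image_idealUF hf hx ψ hI β hβ σ hc hσ
    refine ⟨fun i => ⟨σ i, c i, hc i, map_xA_of_map_X ψ β hβ σ hσ i, hrσ i⟩,
      bijective_of_image_idealUF ψ hB hI ((hβ _).trans
        (congrArg _ (map_monomialX_eq_C_mul_self β σ hσ hrσ)))⟩
end
end
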